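/- arXiv:1903.01793 — 3 statements merged into one kernel-verified Lean document; each statement's English description precedes it below -/
import Mathlib

section
/- Let f₀ : ℝ → ℝ be continuously differentiable with f₀(v) → 0 as v → ±∞, set φ = f₀′, assume φ integrable with bounded derivative, and suppose there are a < c < b with φ > 0 on (−∞,a) ∪ (c,b), φ < 0 on (a,c) ∪ (b,∞), f₀(a) = f₀(b) > 0 and f₀(c) = 0. Fix k ≠ 0. If there exist σ ∈ (0, c−a) and τ ∈ (0, b−c) such that ( σ·f₀(a+σ) ) / ( (c−a−σ)(c−a) ) + ( τ·f₀(b−τ) ) / ( (b−c−τ)(b−c) ) > k², then there exists exactly one λ ∈ ℂ with Re λ > 0 and Δ(k,λ) = 0. -/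
open MeasureTheory Complex Filter

/-- The Landau dispersion function
`Δ(k,λ) = 1 + (1/(ik)) ∫ φ(v)/(ikv + λ) dv`. -/
noncomputable def Landau (φ : ℝ → ℝ) (k : ℝ) (l : ℂ) : ℂ :=
  1 + (1 / (Complex.I * k)) * ∫ v : ℝ, (φ v : ℂ) / (Complex.I * k * v + l)


/-- Cauchy transform. -/
noncomputable def Fz (φ : ℝ → ℝ) (z : ℂ) : ℂ := ∫ v : ℝ, (φ v : ℂ) / ((v : ℂ) - z)

lemma sub_ne_zero_im {z : ℂ} (hz : z.im ≠ 0) (v : ℝ) : (v : ℂ) - z ≠ 0 := by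
  intro h
  apply hz
  have := congrArg Complex.im h
  simpa using this

lemma im_le_norm_sub (z : ℂ) (v : ℝ) : |z.im| ≤ ‖(v : ℂ) - z‖ := by
  have := Complex.abs_im_le_norm ((v : ℂ) - z)
  simpa using this

lemma re_le_norm_sub (z : ℂ) (v : ℝ) : |v - z.re| ≤ ‖(v : ℂ) - z‖ := by
  have := Complex.abs_re_le_norm ((v : ℂ) - z)
  simpa using this

lemma Fz_integrable {φ : ℝ → ℝ} (hint : Integrable φ) {z : ℂ} (hz : z.im ≠ 0) :
    Integrable (fun v : ℝ => (φ v : ℂ) / ((v : ℂ) - z)) := by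
  have h1 : Integrable (fun v : ℝ => (φ v : ℂ)) := hint.ofReal
  have h2 : Continuous (fun v : ℝ => ((v : ℂ) - z)⁻¹) :=
    Continuous.inv₀ (by fun_prop) (sub_ne_zero_im hz)
  refine (h1.mul_bdd (c := |z.im|⁻¹) h2.aestronglyMeasurable ?_).congr ?_
  · refine Filter.Eventually.of_forall fun v => ?_
    rw [norm_inv]
    exact inv_anti₀ (abs_pos.2 hz) (im_le_norm_sub z v)
  · exact Filter.Eventually.of_forall fun v => by simp [div_eq_mul_inv]

lemma Fz_norm_le {φ : ℝ → ℝ} (hint : Integrable φ) {z : ℂ} (hz : 0 < z.im) :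
    ‖Fz φ z‖ * z.im ≤ ∫ v, |φ v| := by
  rw [← le_div_iff₀ hz, ← integral_div]
  refine norm_integral_le_of_norm_le (hint.abs.div_const _) ?_
  refine Filter.Eventually.of_forall fun v => ?_
  rw [norm_div, Complex.norm_real, Real.norm_eq_abs]
  have := im_le_norm_sub z v
  rw [abs_of_pos hz] at this
  gcongr

lemma Fz_conj (φ : ℝ → ℝ) (z : ℂ) : Fz φ ((starRingEnd ℂ) z) = (starRingEnd ℂ) (Fz φ z) := by
  unfold Fz
  rw [← integral_conj]
  congr 1
  ext v
  simp

lemma Landau_iff (φ : ℝ → ℝ) {k : ℝ} (hk : k ≠ 0) (l : ℂ) :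
    Landau φ k l = 0 ↔ Fz φ (I * l / k) = ((k ^ 2 : ℝ) : ℂ) := by
  have hk' : (k : ℂ) ≠ 0 := by exact_mod_cast hk
  have : ∫ v : ℝ, (φ v : ℂ) / (I * k * v + l) = (1 / (I * k)) * Fz φ (I * l / k) := by
    unfold Fz
    rw [← integral_const_mul]
    congr 1
    ext v
    have : I * k * v + l = (I * k) * ((v : ℂ) - I * l / k) := by
      field_simp
      ring_nf
      simp
    rw [this]
    simp only [div_eq_mul_inv, mul_inv]
    ring
  unfold Landau
  rw [this]
  have h2 : 1 / (I * (k : ℂ)) * (1 / (I * k) * Fz φ (I * l / k)) = - (Fz φ (I * l / k) / k ^ 2) := by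
    field_simp
    simp
  rw [h2]
  push_cast
  rw [← sub_eq_add_neg, sub_eq_zero, eq_comm, div_eq_one_iff_eq (pow_ne_zero 2 hk')]

lemma Fz_differentiableOn {φ : ℝ → ℝ} (hint : Integrable φ) :
    DifferentiableOn ℂ (Fz φ) {z : ℂ | 0 < z.im} := by
  intro z hz
  have hz : 0 < z.im := hz
  apply DifferentiableAt.differentiableWithinAt
  have hε : 0 < z.im / 2 := by linarith
  have key : ∀ w ∈ Metric.ball z (z.im / 2), z.im / 2 ≤ w.im := by
    intro w hw
    rw [Metric.mem_ball, Complex.dist_eq] at hw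
    have := (Complex.abs_im_le_norm (w - z)).trans hw.le
    rw [Complex.sub_im, abs_le] at this
    linarith
  have := hasDerivAt_integral_of_dominated_loc_of_deriv_le (μ := volume) (𝕜 := ℂ)
    (F := fun w (v : ℝ) => (φ v : ℂ) / ((v : ℂ) - w))
    (F' := fun w (v : ℝ) => (φ v : ℂ) / ((v : ℂ) - w) ^ 2)
    (bound := fun v => |φ v| / (z.im / 2) ^ 2) (x₀ := z) (s := Metric.ball z (z.im / 2))
    (Metric.ball_mem_nhds z hε) ?_ (Fz_integrable hint hz.ne') ?_ ?_ (hint.abs.div_const _) ?_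
  · exact this.2.differentiableAt
  · filter_upwards [Metric.ball_mem_nhds z hε] with w hw
    exact (Fz_integrable hint (by linarith [key w hw] : 0 < w.im).ne').aestronglyMeasurable
  · have h2 : Continuous (fun v : ℝ => (((v : ℂ) - z) ^ 2)⁻¹) :=
      Continuous.inv₀ (by fun_prop) (fun v => pow_ne_zero 2 (sub_ne_zero_im hz.ne' v))
    simp only [div_eq_mul_inv]
    exact (hint.ofReal (𝕜 := ℂ)).aestronglyMeasurable.mul h2.aestronglyMeasurable
  · refine Filter.Eventually.of_forall fun v w hw => ?_
    rw [norm_div, Complex.norm_real, Real.norm_eq_abs, norm_pow]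
    have h1 := key w hw
    have h2 := im_le_norm_sub w v
    rw [abs_of_pos (by linarith : 0 < w.im)] at h2
    have h3 := h1.trans h2
    gcongr
  · refine Filter.Eventually.of_forall fun v w hw => ?_
    have h1 := key w hw
    have h0 : (v : ℂ) - w ≠ 0 := sub_ne_zero_im (by linarith : 0 < w.im).ne' v
    have hd : HasDerivAt (fun w : ℂ => (v : ℂ) - w) (-1) w := by
      simpa using (hasDerivAt_id w).const_sub (v : ℂ)
    have := (hasDerivAt_const w (φ v : ℂ)).div hd h0
    have e : (0 * ((v : ℂ) - w) - (φ v : ℂ) * -1) / ((v : ℂ) - w) ^ 2 =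
      (φ v : ℂ) / ((v : ℂ) - w) ^ 2 := by simp
    rw [e] at this
    exact this

lemma quad_int {h : ℝ → ℝ} (hh : Integrable h) (x : ℝ) {y : ℝ} (hy : y ≠ 0) :
    Integrable (fun v => h v / ((v - x) ^ 2 + y ^ 2)) ∧
    Integrable (fun v => v * h v / ((v - x) ^ 2 + y ^ 2)) ∧
    Integrable (fun v => v ^ 2 * h v / ((v - x) ^ 2 + y ^ 2)) := by
  have hy2 : 0 < y ^ 2 := by positivity
  have hp : ∀ v, 0 < (v - x) ^ 2 + y ^ 2 := fun v => by positivity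
  have i1 : Integrable (fun v => h v / ((v - x) ^ 2 + y ^ 2)) := by
    have h2 : Continuous (fun v : ℝ => ((v - x) ^ 2 + y ^ 2)⁻¹) :=
      Continuous.inv₀ (by fun_prop) (fun v => (hp v).ne')
    simp only [div_eq_mul_inv]
    refine hh.mul_bdd (c := (y ^ 2)⁻¹) h2.aestronglyMeasurable ?_
    refine Filter.Eventually.of_forall fun v => ?_
    rw [norm_inv, Real.norm_eq_abs, abs_of_pos (hp v)]
    exact inv_anti₀ hy2 (by nlinarith [sq_nonneg (v - x)])
  have i2 : Integrable (fun v => v * h v / ((v - x) ^ 2 + y ^ 2)) := by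
    have h2 : Continuous (fun v : ℝ => v / ((v - x) ^ 2 + y ^ 2)) :=
      Continuous.div (by fun_prop) (by fun_prop) (fun v => (hp v).ne')
    refine (hh.mul_bdd (c := (1 + |x|) / y ^ 2 + 1) h2.aestronglyMeasurable ?_).congr
      (Filter.Eventually.of_forall fun v => by simp only []; ring)
    refine Filter.Eventually.of_forall fun v => ?_
    rw [norm_div, Real.norm_eq_abs, Real.norm_eq_abs, abs_of_pos (hp v), div_le_iff₀ (hp v)]
    have e1 : (1 + |x|) / y ^ 2 * y ^ 2 = 1 + |x| := by field_simp
    have e2 : 0 ≤ (1 + |x|) / y ^ 2 := by positivity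
    have e3 : |v| ≤ |v - x| + |x| := by
      have := abs_add_le (v - x) x
      simpa using this
    have e4 : (v - x) ^ 2 = |v - x| ^ 2 := (sq_abs _).symm
    have e5 := mul_nonneg e2 (sq_nonneg (v - x))
    nlinarith [sq_nonneg (|v - x| - 1), abs_nonneg (v - x)]
  refine ⟨i1, i2, ?_⟩
  refine ((hh.add (i2.const_mul (2 * x))).sub (i1.const_mul (x ^ 2 + y ^ 2))).congr
    (Filter.Eventually.of_forall fun v => ?_)
  simp only [Pi.add_apply, Pi.sub_apply]
  have := (hp v).ne'
  field_simp
  ring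

lemma Fz_parts {φ : ℝ → ℝ} (hint : Integrable φ) {z : ℂ} (hz : z.im ≠ 0) {κ : ℝ}
    (h : Fz φ z = κ) :
    (∫ v, φ v / ((v - z.re) ^ 2 + z.im ^ 2)) = 0 ∧
    (∫ v, v * φ v / ((v - z.re) ^ 2 + z.im ^ 2)) = κ := by
  obtain ⟨i1, i2, -⟩ := quad_int hint z.re hz
  have hi := Fz_integrable hint hz
  have hp : ∀ v, 0 < (v - z.re) ^ 2 + z.im ^ 2 := fun v => by positivity
  have e : ∀ v : ℝ, (φ v : ℂ) / ((v : ℂ) - z) =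
      ((φ v * (v - z.re) / ((v - z.re) ^ 2 + z.im ^ 2) : ℝ) : ℂ) +
      ((φ v * z.im / ((v - z.re) ^ 2 + z.im ^ 2) : ℝ) : ℂ) * I := by
    intro v
    have h0 := sub_ne_zero_im hz v
    have hp' : (((v - z.re) ^ 2 + z.im ^ 2 : ℝ) : ℂ) ≠ 0 := by exact_mod_cast (hp v).ne'
    have hz' : z = (z.re : ℂ) + z.im * I := (Complex.re_add_im z).symm
    have : (((v - z.re) ^ 2 + z.im ^ 2 : ℝ) : ℂ) = (v - z) * (((v - z.re : ℝ) : ℂ) + z.im * I) := by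
      nth_rw 3 [hz']
      push_cast
      ring_nf
      simp
    rw [div_eq_iff h0, Complex.ofReal_div, Complex.ofReal_div]
    field_simp
    rw [Complex.ofReal_mul, Complex.ofReal_mul, this]
    ring
  have hre := congrArg Complex.re h
  have him := congrArg Complex.im h
  unfold Fz at hre him
  have hre' := integral_re hi
  have him' := integral_im hi
  simp only [RCLike.re_to_complex, RCLike.im_to_complex] at hre' him'
  rw [← hre'] at hre
  rw [← him'] at him
  simp only [e, Complex.add_re, Complex.add_im, Complex.ofReal_re, Complex.ofReal_im,
    Complex.re_ofReal_mul, Complex.im_ofReal_mul, Complex.I_re, Complex.I_im, mul_zero, mul_one,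
    add_zero, zero_add] at hre him
  have A : (∫ v, φ v / ((v - z.re) ^ 2 + z.im ^ 2)) = 0 := by
    have : ∀ v, φ v * z.im / ((v - z.re) ^ 2 + z.im ^ 2) =
      z.im * (φ v / ((v - z.re) ^ 2 + z.im ^ 2)) := fun v => by ring
    simp only [this] at him
    rw [integral_const_mul] at him
    exact (mul_eq_zero.1 him).resolve_left hz
  refine ⟨A, ?_⟩
  have : ∀ v, φ v * (v - z.re) / ((v - z.re) ^ 2 + z.im ^ 2) =
      v * φ v / ((v - z.re) ^ 2 + z.im ^ 2) - z.re * (φ v / ((v - z.re) ^ 2 + z.im ^ 2)) :=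
    fun v => by ring
  simp only [this] at hre
  rw [integral_sub i2 (i1.const_mul _), integral_const_mul, A] at hre
  simpa using hre

lemma lin4 {f3 f2 f1 f0 : ℝ → ℝ} (h3 : Integrable f3) (h2 : Integrable f2) (h1 : Integrable f1)
    (h0 : Integrable f0) (p q r : ℝ) :
    ∫ v, (f3 v + p * f2 v + q * f1 v + r * f0 v) =
      (∫ v, f3 v) + p * (∫ v, f2 v) + q * (∫ v, f1 v) + r * ∫ v, f0 v := by
  have a := h3.add (h2.const_mul p)
  have b := a.add (h1.const_mul q)
  have e3 := integral_add b (h0.const_mul r)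
  have e2 := integral_add a (h1.const_mul q)
  have e1 := integral_add h3 (h2.const_mul p)
  simp only [Pi.add_apply, integral_const_mul] at e1 e2 e3
  rw [e3, e2, e1]

lemma lin3 {f2 f1 f0 : ℝ → ℝ} (h2 : Integrable f2) (h1 : Integrable f1)
    (h0 : Integrable f0) (p q : ℝ) :
    ∫ v, (f2 v + p * f1 v + q * f0 v) = (∫ v, f2 v) + p * (∫ v, f1 v) + q * ∫ v, f0 v := by
  have := lin4 h2 h1 h0 h0 p q 0
  simpa using this

lemma Fz_unique {φ : ℝ → ℝ} (hint : Integrable φ) {a b c : ℝ}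
    (hs : ∀ v, (v - a) * (v - b) * (v - c) * φ v ≤ 0)
    {z w : ℂ} (hzw : 0 < z.im * w.im) {κ : ℝ} (hκ : 0 < κ)
    (h0 : Fz φ z = κ) (h1 : Fz φ w = κ) : z = w := by
  have hz : z.im ≠ 0 := by rintro h; simp [h] at hzw
  have hw : w.im ≠ 0 := by rintro h; simp [h] at hzw
  obtain ⟨A0, B0⟩ := Fz_parts hint hz h0
  obtain ⟨A1, B1⟩ := Fz_parts hint hw h1
  obtain ⟨i0, i1, -⟩ := quad_int hint z.re hz
  obtain ⟨j0, j1, j2⟩ := quad_int i0 w.re hw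
  obtain ⟨-, -, j3⟩ := quad_int i1 w.re hw
  set x := z.re with hx
  set y := z.im with hy
  set x' := w.re with hx'
  set y' := w.im with hy'
  have hp : ∀ v, (v - x) ^ 2 + y ^ 2 ≠ 0 := fun v => by positivity
  have hq : ∀ v, (v - x') ^ 2 + y' ^ 2 ≠ 0 := fun v => by positivity
  set g : ℝ → ℝ := fun v => φ v / ((v - x) ^ 2 + y ^ 2) / ((v - x') ^ 2 + y' ^ 2) with hg
  have k1 : Integrable (fun v => v * g v) := j1.congr
    (Filter.Eventually.of_forall fun v => by simp only [hg]; ring)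
  have k2 : Integrable (fun v => v ^ 2 * g v) := j2.congr
    (Filter.Eventually.of_forall fun v => by simp only [hg]; ring)
  have k3 : Integrable (fun v => v ^ 3 * g v) := j3.congr
    (Filter.Eventually.of_forall fun v => by simp only [hg]; ring)
  have k0 : Integrable g := j0
  set I0 := ∫ v, g v
  set I1 := ∫ v, v * g v with hI1
  set I2 := ∫ v, v ^ 2 * g v with hI2
  set I3 := ∫ v, v ^ 3 * g v with hI3
  have EA0 : I2 + (-2 * x') * I1 + (x' ^ 2 + y' ^ 2) * I0 = 0 := by
    rw [← A0]
    refine Eq.trans (lin3 k2 k1 k0 _ _).symm ?_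
    congr 1
    ext v
    have := hp v
    have := hq v
    simp only [hg]
    field_simp
    ring
  have EA1 : I2 + (-2 * x) * I1 + (x ^ 2 + y ^ 2) * I0 = 0 := by
    rw [← A1]
    refine Eq.trans (lin3 k2 k1 k0 _ _).symm ?_
    congr 1
    ext v
    have := hp v
    have := hq v
    simp only [hg]
    field_simp
    ring
  have EB0 : I3 + (-2 * x') * I2 + (x' ^ 2 + y' ^ 2) * I1 = κ := by
    rw [← B0]
    refine Eq.trans (lin3 k3 k2 k1 _ _).symm ?_
    congr 1
    ext v
    have := hp v
    have := hq v
    simp only [hg]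
    field_simp
    ring
  have EB1 : I3 + (-2 * x) * I2 + (x ^ 2 + y ^ 2) * I1 = κ := by
    rw [← B1]
    refine Eq.trans (lin3 k3 k2 k1 _ _).symm ?_
    congr 1
    ext v
    have := hp v
    have := hq v
    simp only [hg]
    field_simp
    ring
  have EN : I3 - (a + b + c) * I2 + (a * b + b * c + a * c) * I1 - (a * b * c) * I0 ≤ 0 := by
    have e0 := lin4 k3 k2 k1 k0 (-(a + b + c)) (a * b + b * c + a * c) (-(a * b * c))
    have e1 : I3 - (a + b + c) * I2 + (a * b + b * c + a * c) * I1 - (a * b * c) * I0 =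
      I3 + -(a + b + c) * I2 + (a * b + b * c + a * c) * I1 + -(a * b * c) * I0 := by ring
    rw [e1]
    refine e0.symm.trans_le ?_
    refine integral_nonpos fun v => ?_
    have e : v ^ 3 * g v + -(a + b + c) * (v ^ 2 * g v) + (a * b + b * c + a * c) * (v * g v)
       + -(a * b * c) * g v = ((v - a) * (v - b) * (v - c) * φ v) /
        (((v - x) ^ 2 + y ^ 2) * ((v - x') ^ 2 + y' ^ 2)) := by
      have := hp v
      have := hq v
      simp only [hg]
      field_simp
      ring
    simp only [Pi.zero_apply]
    rw [e]
    exact div_nonpos_of_nonpos_of_nonneg (hs v) (by positivity)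
  by_contra hne
  have hzero : I0 = 0 ∧ I1 = 0 ∧ I2 = 0 := by
    set d := 2 * (x - x') with hd
    set e := x ^ 2 + y ^ 2 - (x' ^ 2 + y' ^ 2) with he
    have r1 : d * I1 = e * I0 := by rw [hd, he]; linear_combination EA0 - EA1
    have r2 : d * I2 = e * I1 := by rw [hd, he]; linear_combination EB0 - EB1
    by_cases hd0 : d = 0
    · have hxx : x = x' := by linarith
      have he0 : e ≠ 0 := by
        intro he0
        apply hne
        have : (y - y') * (y + y') = 0 := by rw [hxx] at he; linear_combination he0 - he
        rcases mul_eq_zero.1 this with h | h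
        · exact Complex.ext hxx (by linarith)
        · have : y' = -y := by linarith
          rw [this] at hzw
          nlinarith [sq_nonneg y]
      rw [hd0, zero_mul] at r1 r2
      have z0 := (mul_eq_zero.1 r1.symm).resolve_left he0
      have z1 := (mul_eq_zero.1 r2.symm).resolve_left he0
      exact ⟨z0, z1, by rw [z0, z1] at EA0; linarith⟩
    · have z0 : I0 = 0 := by
        have : (((e / d) - x') ^ 2 + y' ^ 2) * I0 = 0 := by
          have q1 : I1 = e / d * I0 := by field_simp; linarith
          have q2 : I2 = e / d * (e / d * I0) := by rw [← q1]; field_simp; linarith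
          rw [q2, q1] at EA0
          linear_combination EA0
        exact (mul_eq_zero.1 this).resolve_left (hq _)
      have z1 : I1 = 0 := by
        rw [z0, mul_zero] at r1; exact (mul_eq_zero.1 r1).resolve_left hd0
      have z2 : I2 = 0 := by
        rw [z1, mul_zero] at r2; exact (mul_eq_zero.1 r2).resolve_left hd0
      exact ⟨z0, z1, z2⟩
  obtain ⟨z0, z1, z2⟩ := hzero
  rw [z0, z1, z2] at EN
  rw [z1, z2] at EB0
  linarith

lemma J_int {z : ℂ} (hz : 0 < z.im) (δ : ℝ) :
    ∫ v in (z.re - δ)..(z.re + δ), ((v : ℂ) - z)⁻¹ = 2 * I * (Real.arctan (δ / z.im) : ℝ) := by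
  have hd : ∀ v ∈ Set.uIcc (z.re - δ) (z.re + δ), HasDerivAt
      (fun v : ℝ => ((1 / 2 * Real.log ((v - z.re) ^ 2 + z.im ^ 2) : ℝ) : ℂ) +
        ((Real.arctan ((v - z.re) / z.im) : ℝ) : ℂ) * I) (((v : ℂ) - z)⁻¹) v := by
    intro v _
    have hp : 0 < (v - z.re) ^ 2 + z.im ^ 2 := by positivity
    have h1 : HasDerivAt (fun v : ℝ => 1 / 2 * Real.log ((v - z.re) ^ 2 + z.im ^ 2))
        ((v - z.re) / ((v - z.re) ^ 2 + z.im ^ 2)) v := by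
      have a1 : HasDerivAt (fun v : ℝ => v - z.re) 1 v := (hasDerivAt_id v).sub_const z.re
      have a2 : HasDerivAt (fun v : ℝ => (v - z.re) ^ 2 + z.im ^ 2) (2 * (v - z.re)) v := by
        simpa using (a1.pow 2).add_const (z.im ^ 2)
      have a3 := (a2.log hp.ne').const_mul (1 / 2)
      have e : 1 / 2 * (2 * (v - z.re) / ((v - z.re) ^ 2 + z.im ^ 2)) =
        (v - z.re) / ((v - z.re) ^ 2 + z.im ^ 2) := by ring
      rwa [e] at a3
    have h2 : HasDerivAt (fun v : ℝ => Real.arctan ((v - z.re) / z.im))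
        (z.im / ((v - z.re) ^ 2 + z.im ^ 2)) v := by
      have a1 : HasDerivAt (fun v : ℝ => (v - z.re) / z.im) (1 / z.im) v :=
        ((hasDerivAt_id v).sub_const z.re).div_const z.im
      have a3 := a1.arctan
      have e : 1 / (1 + ((v - z.re) / z.im) ^ 2) * (1 / z.im) =
        z.im / ((v - z.re) ^ 2 + z.im ^ 2) := by field_simp; ring
      rwa [e] at a3
    have h3 := (h1.ofReal_comp).add ((h2.ofReal_comp).mul_const I)
    have e : (((v - z.re) / ((v - z.re) ^ 2 + z.im ^ 2) : ℝ) : ℂ) +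
        ((z.im / ((v - z.re) ^ 2 + z.im ^ 2) : ℝ) : ℂ) * I = ((v : ℂ) - z)⁻¹ := by
      have h0 := sub_ne_zero_im hz.ne' v
      have hp' : (((v - z.re) ^ 2 + z.im ^ 2 : ℝ) : ℂ) ≠ 0 := by exact_mod_cast hp.ne'
      have hz' : z = (z.re : ℂ) + z.im * I := (Complex.re_add_im z).symm
      have : (((v - z.re) ^ 2 + z.im ^ 2 : ℝ) : ℂ) =
          (v - z) * (((v - z.re : ℝ) : ℂ) + z.im * I) := by
        nth_rw 3 [hz']
        push_cast
        ring_nf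
        simp
      rw [eq_comm, inv_eq_iff_eq_inv, eq_comm, inv_eq_iff_eq_inv, eq_comm, inv_eq_one_div,
        div_eq_iff h0, Complex.ofReal_div, Complex.ofReal_div]
      field_simp
      rw [this]
      ring
    rw [e] at h3
    exact h3
  rw [intervalIntegral.integral_eq_sub_of_hasDerivAt hd]
  · have : (z.re - δ - z.re) / z.im = - (δ / z.im) := by ring
    rw [this, Real.arctan_neg]
    have : (z.re + δ - z.re) / z.im = (δ / z.im) := by ring
    rw [this]
    have e1 : (z.re - δ - z.re) ^ 2 = δ ^ 2 := by ring
    have e2 : (z.re + δ - z.re) ^ 2 = δ ^ 2 := by ring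
    rw [e1, e2]
    push_cast
    ring
  · apply Continuous.intervalIntegrable
    exact Continuous.inv₀ (by fun_prop) (sub_ne_zero_im hz.ne')

/-- Regularised density. -/
noncomputable def gx (φ : ℝ → ℝ) (δ x v : ℝ) : ℝ :=
  φ v - Set.indicator (Set.Icc (x - δ) (x + δ)) (fun _ => φ x) v

lemma Fz_formula {φ : ℝ → ℝ} (hint : Integrable φ) {z : ℂ} (hz : 0 < z.im) {δ : ℝ} (hδ : 0 < δ) :
    Fz φ z = (∫ v : ℝ, (gx φ δ z.re v : ℂ) / ((v : ℂ) - z)) +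
      (φ z.re : ℂ) * (2 * I * (Real.arctan (δ / z.im) : ℝ)) := by
  have hle : z.re - δ ≤ z.re + δ := by linarith
  have hc : Continuous (fun v : ℝ => ((v : ℂ) - z)⁻¹) :=
    Continuous.inv₀ (by fun_prop) (sub_ne_zero_im hz.ne')
  have hi : IntegrableOn (fun v : ℝ => (φ z.re : ℂ) * ((v : ℂ) - z)⁻¹)
      (Set.Icc (z.re - δ) (z.re + δ)) :=
    (continuous_const.mul hc).continuousOn.integrableOn_compact isCompact_Icc
  have e : ∀ v : ℝ, (gx φ δ z.re v : ℂ) / ((v : ℂ) - z) = (φ v : ℂ) / ((v : ℂ) - z) -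
      Set.indicator (Set.Icc (z.re - δ) (z.re + δ))
        (fun v : ℝ => (φ z.re : ℂ) * ((v : ℂ) - z)⁻¹) v := by
    intro v
    unfold gx
    by_cases hv : v ∈ Set.Icc (z.re - δ) (z.re + δ)
    · simp only [Set.indicator_of_mem hv]
      push_cast
      ring
    · simp only [Set.indicator_of_notMem hv]
      simp
  simp only [e]
  rw [integral_sub (Fz_integrable hint hz.ne') (hi.integrable_indicator measurableSet_Icc),
    integral_indicator measurableSet_Icc, integral_const_mul, integral_Icc_eq_integral_Ioc,
    ← intervalIntegral.integral_of_le hle, J_int hz]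
  unfold Fz
  ring

lemma gx_bound {φ : ℝ → ℝ} {C : ℝ} (hL : ∀ x y, |φ x - φ y| ≤ C * |x - y|) {δ : ℝ}
    (hδ : 0 < δ) (z : ℂ) (v : ℝ) :
    ‖(gx φ δ z.re v : ℂ) / ((v : ℂ) - z)‖ ≤
      Set.indicator (Set.Icc (z.re - δ) (z.re + δ)) (fun _ => C) v + |φ v| / max δ |v - z.re| := by
  have hC : 0 ≤ C := by
    have := (abs_nonneg _).trans (hL 1 0)
    simpa using this
  have hr := re_le_norm_sub z v
  have hm : 0 < max δ |v - z.re| := lt_max_of_lt_left hδ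
  rw [norm_div, Complex.norm_real, Real.norm_eq_abs]
  unfold gx
  by_cases hv : v ∈ Set.Icc (z.re - δ) (z.re + δ)
  · simp only [Set.indicator_of_mem hv]
    have : 0 ≤ |φ v| / max δ |v - z.re| := by positivity
    have : |φ v - φ z.re| / ‖(v : ℂ) - z‖ ≤ C := by
      apply div_le_of_le_mul₀ (norm_nonneg _) hC
      exact (hL v z.re).trans (by gcongr)
    linarith
  · simp only [Set.indicator_of_notMem hv, sub_zero, zero_add]
    have h1 : δ < |v - z.re| := by
      by_contra h
      rw [not_lt, abs_le] at h
      exact hv ⟨by linarith [h.1], by linarith [h.2]⟩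
    rw [max_eq_right h1.le]
    have : 0 < |v - z.re| := hδ.trans h1
    gcongr

lemma gx_meas {φ : ℝ → ℝ} (hφ : Continuous φ) (δ : ℝ) (z : ℂ) :
    AEStronglyMeasurable (fun v : ℝ => (gx φ δ z.re v : ℂ) / ((v : ℂ) - z)) volume := by
  apply Measurable.aestronglyMeasurable
  apply Measurable.div
  · apply Complex.measurable_ofReal.comp
    exact hφ.measurable.sub (measurable_const.indicator measurableSet_Icc)
  · fun_prop

lemma ind_int (p q C : ℝ) : Integrable (Set.indicator (Set.Icc p q) (fun _ : ℝ => C)) :=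
  (integrable_indicator_iff measurableSet_Icc).2
    (continuous_const.continuousOn.integrableOn_compact isCompact_Icc)

/-- Boundary real part. -/
noncomputable def Lb (φ : ℝ → ℝ) (u : ℝ) : ℝ := ∫ v : ℝ, gx φ 1 u v / (v - u)

lemma Fz_boundary {φ : ℝ → ℝ} (hφ : Continuous φ) (hint : Integrable φ)
    {C : ℝ} (hL : ∀ x y, |φ x - φ y| ≤ C * |x - y|) (u : ℝ) :
    Tendsto (Fz φ) (nhdsWithin (u : ℂ) {z | 0 < z.im})
      (nhds ((Lb φ u : ℂ) + ((Real.pi * φ u : ℝ) : ℂ) * I)) := by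
  have hC : 0 ≤ C := by
    have := (abs_nonneg _).trans (hL 1 0)
    simpa using this
  set l := nhdsWithin (u : ℂ) {z | 0 < z.im} with hl
  have hid : Tendsto (fun z : ℂ => z) l (nhds (u : ℂ)) := tendsto_nhdsWithin_of_tendsto_nhds tendsto_id
  have hre : Tendsto (fun z : ℂ => z.re) l (nhds u) := by
    have := (Complex.continuous_re.tendsto (u : ℂ)).comp hid
    rw [Complex.ofReal_re] at this
    exact this
  have him : Tendsto (fun z : ℂ => z.im) l (nhdsWithin 0 (Set.Ioi 0)) := by
    refine tendsto_nhdsWithin_iff.2 ⟨?_, eventually_mem_nhdsWithin⟩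
    have := (Complex.continuous_im.tendsto (u : ℂ)).comp hid
    rw [Complex.ofReal_im] at this
    exact this
  have hmem : ∀ᶠ z in l, 0 < z.im := eventually_mem_nhdsWithin
  have t1 : Tendsto (fun z : ℂ => ∫ v : ℝ, (gx φ 1 z.re v : ℂ) / ((v : ℂ) - z)) l
      (nhds (∫ v : ℝ, (gx φ 1 u v : ℂ) / ((v : ℂ) - u))) := by
    refine tendsto_integral_filter_of_dominated_convergence
      (fun v => Set.indicator (Set.Icc (u - 2) (u + 2)) (fun _ => C) v + |φ v|)
      (Filter.Eventually.of_forall fun z => gx_meas hφ 1 z) ?_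
      ((ind_int _ _ _).add hint.abs) ?_
    · have : ∀ᶠ z : ℂ in l, z.re ∈ Metric.ball u 1 := hre (Metric.ball_mem_nhds u one_pos)
      filter_upwards [this] with z hz
      refine Filter.Eventually.of_forall fun v => (gx_bound hL one_pos z v).trans ?_
      rw [Metric.mem_ball, Real.dist_eq, abs_lt] at hz
      apply add_le_add
      · apply Set.indicator_le_indicator_of_subset _ (fun _ => hC)
        exact Set.Icc_subset_Icc (by linarith) (by linarith)
      · exact div_le_self (abs_nonneg _) (le_max_left _ _)
    · have hne : ∀ w : ℝ, ∀ᵐ v : ℝ, v ≠ w := fun w => Measure.ae_ne volume w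
      filter_upwards [hne u, hne (u - 1), hne (u + 1)] with v h0 h1 h2
      have hden : Tendsto (fun z : ℂ => (v : ℂ) - z) l (nhds ((v : ℂ) - u)) := hid.const_sub _
      have hden0 : (v : ℂ) - u ≠ 0 := by
        rw [← Complex.ofReal_sub]
        exact_mod_cast sub_ne_zero.2 h0
      refine Tendsto.div ?_ hden hden0
      refine (Complex.continuous_ofReal.tendsto _).comp ?_
      by_cases hv : v ∈ Set.Icc (u - 1) (u + 1)
      · have a1 : u - 1 < v := lt_of_le_of_ne hv.1 h1.symm
        have a2 : v < u + 1 := lt_of_le_of_ne hv.2 h2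
        have E : ∀ᶠ z : ℂ in l, gx φ 1 z.re v = φ v - φ z.re := by
          have : ∀ᶠ z : ℂ in l, z.re ∈ Set.Ioo (v - 1) (v + 1) :=
            hre (Ioo_mem_nhds (by linarith) (by linarith))
          filter_upwards [this] with z hz
          unfold gx
          rw [Set.indicator_of_mem]
          exact ⟨by linarith [hz.2], by linarith [hz.1]⟩
        have E' : gx φ 1 u v = φ v - φ u := by
          unfold gx
          rw [Set.indicator_of_mem hv]
        rw [E', tendsto_congr' E]
        exact ((hφ.tendsto u).comp hre).const_sub _
      · have E' : gx φ 1 u v = φ v := by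
          unfold gx
          rw [Set.indicator_of_notMem hv, sub_zero]
        have E : ∀ᶠ z : ℂ in l, gx φ 1 z.re v = φ v := by
          have : ∀ᶠ z : ℂ in l, z.re ∈ (Set.Icc (v - 1) (v + 1))ᶜ := by
            refine hre (isClosed_Icc.isOpen_compl.mem_nhds ?_)
            intro h
            exact hv ⟨by linarith [h.2], by linarith [h.1]⟩
          filter_upwards [this] with z hz
          unfold gx
          rw [Set.indicator_of_notMem, sub_zero]
          intro h
          exact hz ⟨by linarith [h.2], by linarith [h.1]⟩
        rw [E', tendsto_congr' E]
        exact tendsto_const_nhds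
  have t2 : Tendsto (fun z : ℂ => (φ z.re : ℂ) * (2 * I * (Real.arctan (1 / z.im) : ℝ))) l
      (nhds ((φ u : ℂ) * (2 * I * ((Real.pi / 2 : ℝ) : ℂ)))) := by
    refine Tendsto.mul ?_ (Tendsto.const_mul _ ?_)
    · exact (Complex.continuous_ofReal.tendsto _).comp ((hφ.tendsto u).comp hre)
    · refine (Complex.continuous_ofReal.tendsto _).comp ?_
      have : Tendsto (fun z : ℂ => 1 / z.im) l atTop := by
        simp only [one_div]
        exact tendsto_inv_nhdsGT_zero.comp him
      exact (tendsto_nhds_of_tendsto_nhdsWithin Real.tendsto_arctan_atTop).comp this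
  have E : (Lb φ u : ℂ) + ((Real.pi * φ u : ℝ) : ℂ) * I =
      (∫ v : ℝ, (gx φ 1 u v : ℂ) / ((v : ℂ) - u)) + (φ u : ℂ) * (2 * I * ((Real.pi / 2 : ℝ) : ℂ)) := by
    have : (Lb φ u : ℂ) = ∫ v : ℝ, (gx φ 1 u v : ℂ) / ((v : ℂ) - u) := by
      unfold Lb
      rw [← integral_complex_ofReal]
      congr 1
      ext v
      push_cast
      rfl
    rw [this]
    push_cast
    ring
  rw [E]
  refine (t1.add t2).congr' ?_
  filter_upwards [hmem] with z hz
  exact (Fz_formula hint hz one_pos).symm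

lemma Lb_zero {φ : ℝ → ℝ} (hφ : Continuous φ) (hint : Integrable φ)
    {C : ℝ} (hL : ∀ x y, |φ x - φ y| ≤ C * |x - y|) {u : ℝ} (hu : φ u = 0) :
    Integrable (fun v => φ v / (v - u)) ∧ Lb φ u = ∫ v, φ v / (v - u) := by
  have hg : ∀ v, gx φ 1 u v = φ v := by
    intro v
    simp [gx, hu]
  constructor
  · refine Integrable.mono' ((ind_int (u - 1) (u + 1) C).add hint.abs)
      (hφ.measurable.div (by fun_prop)).aestronglyMeasurable ?_
    refine Filter.Eventually.of_forall fun v => ?_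
    have := gx_bound hL one_pos (u : ℂ) v
    simp only [Complex.ofReal_re, hg, ← Complex.ofReal_sub, ← Complex.ofReal_div,
      Complex.norm_real] at this
    refine this.trans ?_
    apply add_le_add le_rfl
    exact div_le_self (abs_nonneg _) (le_max_left _ _)
  · simp [Lb, hg]

lemma Fz_bound {φ : ℝ → ℝ} (hφ : Continuous φ) (hint : Integrable φ)
    {C : ℝ} (hL : ∀ x y, |φ x - φ y| ≤ C * |x - y|) {δ : ℝ} (hδ : 0 < δ) {z : ℂ} (hz : 0 < z.im) {x : ℝ}
    (hzx : z.re = x) :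
    ‖Fz φ z‖ ≤ 2 * δ * C + (∫ v, |φ v| / max δ |v - x|) + |φ x| * Real.pi := by
  rw [Fz_formula hint hz hδ]
  have hmi : Integrable (fun v => |φ v| / max δ |v - z.re|) := by
    refine Integrable.mono' (hint.abs.div_const δ)
      (hφ.abs.measurable.div (by fun_prop)).aestronglyMeasurable ?_
    refine Filter.Eventually.of_forall fun v => ?_
    have hm : 0 < max δ |v - z.re| := lt_max_of_lt_left hδ
    rw [Real.norm_eq_abs, abs_of_nonneg (by positivity)]
    have := le_max_left δ |v - z.re|
    gcongr
  have b1 : ‖∫ v : ℝ, (gx φ δ z.re v : ℂ) / ((v : ℂ) - z)‖ ≤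
      2 * δ * C + (∫ v, |φ v| / max δ |v - x|) := by
    have := norm_integral_le_of_norm_le
      ((ind_int (z.re - δ) (z.re + δ) C).add hmi)
      (Filter.Eventually.of_forall (gx_bound hL hδ z))
    refine this.trans (le_of_eq ?_)
    have e := integral_add (ind_int (z.re - δ) (z.re + δ) C) hmi
    simp only [Pi.add_apply] at e ⊢
    rw [e, integral_indicator measurableSet_Icc, setIntegral_const, ← hzx]
    congr 1
    rw [Real.volume_real_Icc_of_le (by linarith), smul_eq_mul]
    ring
  refine (norm_add_le _ _).trans (add_le_add b1 ?_)
  rw [norm_mul, norm_mul, norm_mul, Complex.norm_I, Complex.norm_real, Complex.norm_real, hzx]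
  have h1 := Real.arctan_lt_pi_div_two (δ / z.im)
  have h2 : 0 ≤ Real.arctan (δ / z.im) := Real.arctan_nonneg.2 (by positivity)
  simp only [Real.norm_eq_abs, abs_of_nonneg h2]
  gcongr
  norm_num
  linarith

lemma Fz_bdd {φ : ℝ → ℝ} (hφ : Continuous φ) (hint : Integrable φ)
    {C : ℝ} (hL : ∀ x y, |φ x - φ y| ≤ C * |x - y|)
    (hφ0 : Tendsto φ (cocompact ℝ) (nhds 0)) : ∃ B : ℝ, ∀ z : ℂ, 0 < z.im → ‖Fz φ z‖ ≤ B := by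
  obtain ⟨M, hM⟩ : ∃ M, ∀ x, |φ x| ≤ M := by
    have := hφ0.abs.eventually_lt_const (by simp : |(0:ℝ)| < 1)
    rw [Filter.Eventually, Filter.mem_cocompact] at this
    obtain ⟨T, hT, hTs⟩ := this
    obtain ⟨M, hM⟩ := hT.exists_bound_of_continuousOn hφ.continuousOn
    refine ⟨max M 1, fun x => ?_⟩
    by_cases hx : x ∈ T
    · exact (hM x hx).trans (le_max_left _ _)
    · exact (le_of_lt (hTs hx)).trans (le_max_right _ _)
  refine ⟨2 * 1 * C + (∫ v, |φ v|) + M * Real.pi, fun z hz => ?_⟩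
  refine (Fz_bound hφ hint hL one_pos hz rfl).trans ?_
  have h1 : (∫ v, |φ v| / max 1 |v - z.re|) ≤ ∫ v, |φ v| := by
    refine integral_mono_of_nonneg (Filter.Eventually.of_forall fun v => ?_) hint.abs
      (Filter.Eventually.of_forall fun v => ?_)
    · have hm : 0 < max 1 |v - z.re| := lt_max_of_lt_left one_pos
      simp only [Pi.zero_apply]
      positivity
    · exact div_le_self (abs_nonneg _) (le_max_left _ _)
  have h2 := mul_le_mul_of_nonneg_right (hM z.re) Real.pi_pos.le
  linarith

lemma Fz_far {φ : ℝ → ℝ} (hφ : Continuous φ) (hint : Integrable φ)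
    {C : ℝ} (hL : ∀ x y, |φ x - φ y| ≤ C * |x - y|)
    (hφ0 : Tendsto φ (cocompact ℝ) (nhds 0)) {ε : ℝ} (hε : 0 < ε) :
    ∀ᶠ x in cocompact ℝ, ∀ z : ℂ, 0 < z.im → z.re = x → ‖Fz φ z‖ < ε := by
  have hC : 0 ≤ C := by
    have := (abs_nonneg _).trans (hL 1 0)
    simpa using this
  set δ := ε / (4 * (C + 1)) with hδd
  have hδ : 0 < δ := by positivity
  have hδC : 2 * δ * C < ε / 2 + 0 := by
    have : δ * (4 * (C + 1)) = ε := by rw [hδd]; field_simp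
    nlinarith
  have : (cocompact ℝ).IsCountablyGenerated := by
    rw [cocompact_eq_atBot_atTop]; infer_instance
  have t1 : Tendsto (fun x : ℝ => ∫ v, |φ v| / max δ |v - x|) (cocompact ℝ) (nhds (∫ _ : ℝ, (0:ℝ))) := by
    refine tendsto_integral_filter_of_dominated_convergence (fun v => |φ v| / δ) ?_ ?_
      (hint.abs.div_const _) ?_
    · refine Filter.Eventually.of_forall fun x => ?_
      exact (hφ.abs.measurable.div (by fun_prop)).aestronglyMeasurable
    · refine Filter.Eventually.of_forall fun x => Filter.Eventually.of_forall fun v => ?_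
      have hm : 0 < max δ |v - x| := lt_max_of_lt_left hδ
      rw [Real.norm_eq_abs, abs_of_nonneg (by positivity)]
      have := le_max_left δ |v - x|
      gcongr
    · refine Filter.Eventually.of_forall fun v => ?_
      refine Tendsto.div_atTop tendsto_const_nhds ?_
      refine tendsto_atTop_mono (fun x => le_max_right _ _) ?_
      have h1 : Tendsto (fun x : ℝ => ‖x‖ - |v|) (cocompact ℝ) atTop :=
        tendsto_atTop_add_const_right _ _ (tendsto_norm_cocompact_atTop (E := ℝ))
      refine tendsto_atTop_mono (fun x => ?_) h1
      have := abs_sub_abs_le_abs_sub x v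
      rw [abs_sub_comm] at this
      simpa using this
  have t2 : Tendsto (fun x : ℝ => 2 * δ * C + (∫ v, |φ v| / max δ |v - x|) + |φ x| * Real.pi)
      (cocompact ℝ) (nhds (2 * δ * C + 0 + |(0:ℝ)| * Real.pi)) := by
    rw [integral_zero] at t1
    exact (t1.const_add _).add (hφ0.abs.mul_const _)
  have : 2 * δ * C + 0 + |(0:ℝ)| * Real.pi < ε := by
    rw [abs_zero]; linarith
  filter_upwards [t2.eventually_lt_const this] with x hx z hz hzx
  refine lt_of_le_of_lt ?_ hx
  exact Fz_bound hφ hint hL hδ hz hzx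

lemma phi_zero {f φ : ℝ → ℝ} (hd : ∀ x, HasDerivAt f (φ x) x)
    {C : ℝ} (hL : ∀ x y, |φ x - φ y| ≤ C * |x - y|)
    (hf : Tendsto f (cocompact ℝ) (nhds 0)) : Tendsto φ (cocompact ℝ) (nhds 0) := by
  have hC : 0 ≤ C := by
    have := (abs_nonneg _).trans (hL 1 0)
    simpa using this
  rw [Metric.tendsto_nhds]
  intro ε hε
  set h := ε / (2 * (C + 1)) with hh
  have hpos : 0 < h := by positivity
  have hCh : C * h < ε / 2 := by
    have : h * (2 * (C + 1)) = ε := by rw [hh]; field_simp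
    nlinarith
  have hsh : Tendsto (fun x : ℝ => x + h) (cocompact ℝ) (cocompact ℝ) :=
    (Homeomorph.addRight h).isClosedEmbedding.tendsto_cocompact
  have t : Tendsto (fun x => |f (x + h) - f x|) (cocompact ℝ) (nhds |(0:ℝ) - 0|) :=
    ((hf.comp hsh).sub hf).abs
  have : |(0:ℝ) - 0| < h * (ε / 2) := by
    rw [sub_zero, abs_zero]; positivity
  filter_upwards [t.eventually_lt_const this] with x hx
  rw [Real.dist_eq, sub_zero]
  obtain ⟨ξ, hξ, e⟩ := exists_hasDerivAt_eq_slope f φ (by linarith : x < x + h)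
    (fun y _ => (hd y).continuousAt.continuousWithinAt) (fun y _ => hd y)
  rw [add_sub_cancel_left] at e
  have h1 : |φ ξ| < ε / 2 := by
    rw [e, abs_div, abs_of_pos hpos, div_lt_iff₀ hpos]
    linarith
  have h2 := hL x ξ
  have h3 : |x - ξ| ≤ h := by
    rw [abs_le]; constructor <;> linarith [hξ.1, hξ.2]
  have h4 : C * |x - ξ| ≤ C * h := by gcongr
  have h5 := abs_add_le (φ x - φ ξ) (φ ξ)
  rw [sub_add_cancel] at h5
  linarith

lemma Fz_closed {φ : ℝ → ℝ} (hφ : Continuous φ) (hint : Integrable φ)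
    {C : ℝ} (hL : ∀ x y, |φ x - φ y| ≤ C * |x - y|)
    (hφ0 : Tendsto φ (cocompact ℝ) (nhds 0)) {κ : ℝ} (hκ : 0 < κ)
    (hb : ∀ u, φ u = 0 → Lb φ u ≠ κ)
    (hcl : (κ : ℂ) ∈ closure (Fz φ '' {z | 0 < z.im})) : (κ : ℂ) ∈ Fz φ '' {z | 0 < z.im} := by
  obtain ⟨w, hw, hwt⟩ := mem_closure_iff_seq_limit.1 hcl
  choose z hz hzw using hw
  have hlim : Tendsto (fun n => Fz φ (z n)) atTop (nhds (κ : ℂ)) := by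
    simpa only [hzw] using hwt
  have hnorm : ∀ᶠ n in atTop, κ / 2 < ‖Fz φ (z n)‖ := by
    have : κ / 2 < ‖(κ : ℂ)‖ := by
      rw [Complex.norm_real, Real.norm_eq_abs, abs_of_pos hκ]; linarith
    exact hlim.norm.eventually_const_lt this
  have hfar := Fz_far hφ hint hL hφ0 (half_pos hκ)
  rw [Filter.Eventually, Filter.mem_cocompact] at hfar
  obtain ⟨T, hT, hTs⟩ := hfar
  set M := ∫ v, |φ v|
  have hcpt : IsCompact (T ×ℂ Set.Icc 0 (M / (κ / 2))) := hT.reProdIm isCompact_Icc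
  have hin : ∀ᶠ n in atTop, z n ∈ (T ×ℂ Set.Icc 0 (M / (κ / 2))) := by
    filter_upwards [hnorm] with n hn
    have hzn : 0 < (z n).im := hz n
    refine ⟨?_, hzn.le, ?_⟩
    · by_contra hnot
      have := hTs hnot (z n) hzn rfl
      linarith
    · change (z n).im ≤ _
      rw [le_div_iff₀ (half_pos hκ)]
      have := Fz_norm_le hint hzn
      nlinarith
  obtain ⟨s, hs, ψ, hψ, hψt⟩ := hcpt.tendsto_subseq' hin.frequently
  have hlim' := hlim.comp hψ.tendsto_atTop
  have him : 0 ≤ s.im := hs.2.1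
  rcases him.lt_or_eq with h | h
  · refine ⟨s, h, ?_⟩
    have hc : ContinuousAt (Fz φ) s :=
      ((Fz_differentiableOn hint).continuousOn).continuousAt
        ((isOpen_lt continuous_const Complex.continuous_im).mem_nhds h)
    exact tendsto_nhds_unique (hc.tendsto.comp hψt) hlim'
  · exfalso
    have hsu : s = (s.re : ℂ) := Complex.ext rfl (by simp [← h])
    have ht : Tendsto (z ∘ ψ) atTop (nhdsWithin (s.re : ℂ) {z | 0 < z.im}) := by
      refine tendsto_nhdsWithin_iff.2 ⟨by rw [← hsu]; exact hψt, ?_⟩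
      exact Filter.Eventually.of_forall fun n => hz _
    have e := tendsto_nhds_unique ((Fz_boundary hφ hint hL s.re).comp ht) hlim'
    have e1 := congrArg Complex.re e
    have e2 := congrArg Complex.im e
    simp only [Complex.add_re, Complex.add_im, Complex.ofReal_re, Complex.ofReal_im,
      Complex.re_ofReal_mul, Complex.im_ofReal_mul, Complex.I_re, Complex.I_im, mul_zero, mul_one,
      add_zero, zero_add] at e1 e2
    exact hb _ ((mul_eq_zero.1 e2).resolve_left Real.pi_pos.ne') e1

lemma Fz_exists {φ : ℝ → ℝ} (hφ : Continuous φ) (hint : Integrable φ)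
    {C : ℝ} (hL : ∀ x y, |φ x - φ y| ≤ C * |x - y|)
    (hφ0 : Tendsto φ (cocompact ℝ) (nhds 0)) {a c b : ℝ} (hac : a < c) (hcb : c < b)
    (hn : ∀ v, a < v → v < c → φ v < 0) (hp : ∀ v, c < v → v < b → 0 < φ v)
    (hc : φ c = 0) (hz : ∀ u, φ u = 0 → u = c ∨ Lb φ u ≤ 0) {κ : ℝ} (hκ : 0 < κ)
    (hκK : κ < Lb φ c) : ∃ z : ℂ, 0 < z.im ∧ Fz φ z = κ := by
  set K := Lb φ c with hK
  have hKpos : 0 < K := hκ.trans hκK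
  set U : Set ℂ := {z | 0 < z.im} with hU
  have hUo : IsOpen U := isOpen_lt continuous_const Complex.continuous_im
  have hUc : IsPreconnected U := (convex_halfSpace_im_gt 0).isPreconnected
  have hdiff := Fz_differentiableOn hint
  have hcont : ContinuousOn (Fz φ) U := hdiff.continuousOn
  -- closeness near c
  have hB := Fz_boundary hφ hint hL c
  rw [hc] at hB
  simp only [mul_zero, Complex.ofReal_zero, zero_mul, add_zero] at hB
  obtain ⟨ρ, hρ, hρs⟩ := Metric.mem_nhdsWithin_iff.1 (hB (Metric.ball_mem_nhds _ hKpos))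
  obtain ⟨r, hr0, hrρ, hra, hrb⟩ : ∃ r, 0 < r ∧ r < ρ / 2 ∧ r < c - a ∧ r < b - c := by
    refine ⟨min (ρ / 2) (min (c - a) (b - c)) / 2, ?_, ?_, ?_, ?_⟩
    · have : 0 < min (ρ / 2) (min (c - a) (b - c)) :=
        lt_min (half_pos hρ) (lt_min (by linarith) (by linarith))
      linarith
    all_goals
      have h0 : 0 < min (ρ / 2) (min (c - a) (b - c)) :=
        lt_min (half_pos hρ) (lt_min (by linarith) (by linarith))
      have h1 := min_le_left (ρ / 2) (min (c - a) (b - c))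
      have h2 := min_le_right (ρ / 2) (min (c - a) (b - c))
      have h3 := min_le_left (c - a) (b - c)
      have h4 := min_le_right (c - a) (b - c)
      linarith
  have vert : ∀ u : ℝ, Tendsto (fun y : ℝ => (u : ℂ) + y * I) (nhdsWithin 0 (Set.Ioi 0))
      (nhdsWithin (u : ℂ) {z | 0 < z.im}) := by
    intro u
    refine tendsto_nhdsWithin_iff.2 ⟨?_, ?_⟩
    · have : Continuous (fun y : ℝ => (u : ℂ) + y * I) := by fun_prop
      have := this.tendsto 0
      simp only [Complex.ofReal_zero, zero_mul, add_zero] at this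
      exact tendsto_nhdsWithin_of_tendsto_nhds this
    · filter_upwards [self_mem_nhdsWithin] with y hy
      simpa using hy
  have vim : ∀ u : ℝ, Tendsto (fun y : ℝ => (Fz φ ((u : ℂ) + y * I)).im) (nhdsWithin 0 (Set.Ioi 0))
      (nhds (Real.pi * φ u)) := by
    intro u
    have := (Complex.continuous_im.tendsto _).comp ((Fz_boundary hφ hint hL u).comp (vert u))
    simpa [Function.comp_def] using this
  have hneg : Real.pi * φ (c - r) < 0 :=
    mul_neg_of_pos_of_neg Real.pi_pos (hn _ (by linarith) (by linarith))
  have hpos : 0 < Real.pi * φ (c + r) :=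
    mul_pos Real.pi_pos (hp _ (by linarith) (by linarith))
  have hsmall : ∀ᶠ y : ℝ in nhdsWithin 0 (Set.Ioi 0), y < ρ / 2 :=
    nhdsWithin_le_nhds (Iio_mem_nhds (half_pos hρ))
  obtain ⟨y, ⟨⟨hy1, hy2⟩, hy3⟩, hy0⟩ := ((((vim (c - r)).eventually_lt_const hneg).and
    ((vim (c + r)).eventually_const_lt hpos)).and hsmall |>.and
      (self_mem_nhdsWithin : ∀ᶠ y : ℝ in nhdsWithin 0 (Set.Ioi 0), y ∈ Set.Ioi (0:ℝ))).exists
  have hy0 : 0 < y := hy0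
  have hline : ∀ x : ℝ, (x : ℂ) + y * I ∈ U := fun x => by
    simpa [hU] using hy0
  have hcx : ContinuousOn (fun x : ℝ => (Fz φ ((x : ℂ) + y * I)).im) (Set.Icc (c - r) (c + r)) := by
    refine Complex.continuous_im.comp_continuousOn (hcont.comp (by fun_prop) (fun x _ => hline x))
  obtain ⟨x, hx, hx0⟩ := intermediate_value_Icc (by linarith : c - r ≤ c + r) hcx ⟨hy1.le, hy2.le⟩
  set z0 : ℂ := (x : ℂ) + y * I with hz0
  have hball : Fz φ z0 ∈ Metric.ball (K : ℂ) K := by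
    refine hρs ⟨?_, hline x⟩
    rw [Metric.mem_ball, Complex.dist_eq]
    have e : z0 - c = ((x - c : ℝ) : ℂ) + (y : ℂ) * I := by rw [hz0]; push_cast; ring
    rw [e]
    refine (norm_add_le _ _).trans_lt ?_
    rw [norm_mul, Complex.norm_I, Complex.norm_real, Complex.norm_real, Real.norm_eq_abs,
      Real.norm_eq_abs, abs_of_pos hy0]
    have : |x - c| ≤ r := by
      rw [abs_le]; constructor <;> linarith [hx.1, hx.2]
    linarith
  set κ0 := (Fz φ z0).re with hκ0
  have hF0 : Fz φ z0 = (κ0 : ℂ) := Complex.ext rfl (by simpa using hx0)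
  have hκ0pos : 0 < κ0 := by
    rw [hF0, Metric.mem_ball, Complex.dist_eq, ← Complex.ofReal_sub, Complex.norm_real,
      Real.norm_eq_abs, abs_lt] at hball
    linarith [hball.1]
  have hopen : IsOpen (Fz φ '' U) := by
    have han : AnalyticOnNhd ℂ (Fz φ) U := hdiff.analyticOnNhd hUo
    rcases han.is_constant_or_isOpen hUc with ⟨w, hw⟩ | h
    · exfalso
      rw [hw _ (hline _)] at hy1 hy2
      linarith
    · exact h U subset_rfl hUo
  have hmem0 : (κ0 : ℂ) ∈ Fz φ '' U := ⟨z0, hline x, hF0⟩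
  have hclosed : ∀ t : ℝ, 0 < t → t ≠ K → (t : ℂ) ∈ closure (Fz φ '' U) → (t : ℂ) ∈ Fz φ '' U := by
    intro t ht htK
    apply Fz_closed hφ hint hL hφ0 ht
    intro u hu
    rcases hz u hu with h | h
    · rw [h]; exact htK.symm
    · linarith
  have hbig : ∀ t : ℝ, K < t → (t : ℂ) ∉ Fz φ '' U := by
    intro t ht hmem
    have hsub : (fun t : ℝ => (t : ℂ)) '' Set.Ioi K ⊆ Fz φ '' U := by
      refine IsPreconnected.subset_of_closure_inter_subset
        (isPreconnected_Ioi.image _ Complex.continuous_ofReal.continuousOn) hopen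
        ⟨t, ⟨t, ht, rfl⟩, hmem⟩ ?_
      rintro _ ⟨h1, ⟨s, hs, rfl⟩⟩
      exact hclosed s (hKpos.trans hs) (ne_of_gt hs) h1
    -- unbounded real roots
    obtain ⟨B, hB⟩ := Fz_bdd hφ hint hL hφ0
    obtain ⟨z, hz1, hz2⟩ := hsub ⟨max B K + 1, lt_of_le_of_lt (le_max_right B K) (lt_add_one _), rfl⟩
    have := hB z hz1
    have hz2 : Fz φ z = ((max B K + 1 : ℝ) : ℂ) := hz2
    rw [hz2, Complex.norm_real, Real.norm_eq_abs] at this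
    linarith [le_max_left B K, le_abs_self (max B K + 1)]
  have hκ0K : κ0 < K := by
    by_contra hnot
    rw [not_lt] at hnot
    rcases hnot.lt_or_eq with h | h
    · exact hbig _ h hmem0
    · have : {t : ℝ | (t : ℂ) ∈ Fz φ '' U} ∈ nhds κ0 :=
        Complex.continuous_ofReal.continuousAt.preimage_mem_nhds (hopen.mem_nhds hmem0)
      obtain ⟨ε, hε, hs⟩ := Metric.mem_nhds_iff.1 this
      have : κ0 + ε / 2 ∈ Metric.ball κ0 ε := by
        rw [Metric.mem_ball, Real.dist_eq, add_sub_cancel_left, abs_of_pos (half_pos hε)]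
        linarith
      exact hbig (κ0 + ε / 2) (by linarith) (hs this)
  have hsub : (fun t : ℝ => (t : ℂ)) '' Set.Ioo 0 K ⊆ Fz φ '' U := by
    refine IsPreconnected.subset_of_closure_inter_subset
      (isPreconnected_Ioo.image _ Complex.continuous_ofReal.continuousOn) hopen
      ⟨κ0, ⟨κ0, ⟨hκ0pos, hκ0K⟩, rfl⟩, hmem0⟩ ?_
    rintro _ ⟨h1, ⟨s, hs, rfl⟩⟩
    exact hclosed s hs.1 (ne_of_lt hs.2) h1
  obtain ⟨z, hz1, hz2⟩ := hsub ⟨κ, ⟨hκ, hκK⟩, rfl⟩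
  exact ⟨z, hz1, hz2⟩

lemma int_piece {φ w : ℝ → ℝ} {s : Set ℝ} (hs : MeasurableSet s) (m : ℝ)
    (hi : Integrable φ) (hw : Integrable w) (h : ∀ v ∈ s, φ v * m ≤ w v) :
    (∫ v in s, φ v) * m ≤ ∫ v in s, w v := by
  rw [← integral_mul_const]
  exact setIntegral_mono_on (hi.mul_const m).integrableOn hw.integrableOn hs h

lemma Lb_c_bound {f φ : ℝ → ℝ} (hd : ∀ x, HasDerivAt f (φ x) x) (hint : Integrable φ)
    (htop : Tendsto f atTop (nhds 0)) (hbot : Tendsto f atBot (nhds 0))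
    {a c b : ℝ} 
    (hp1 : ∀ v : ℝ, v < a → 0 < φ v)
    (hp2 : ∀ v : ℝ, c < v → v < b → 0 < φ v)
    (hn1 : ∀ v : ℝ, a < v → v < c → φ v < 0)
    (hn2 : ∀ v : ℝ, b < v → φ v < 0) (ha : φ a = 0) (hb : φ b = 0) (hc : φ c = 0)
    (hc0 : f c = 0) (hi : Integrable (fun v => φ v / (v - c)))
    (σ τ : ℝ) (hσ : σ ∈ Set.Ioo 0 (c - a)) (hτ : τ ∈ Set.Ioo 0 (b - c)) :
    σ * f (a + σ) / ((c - a - σ) * (c - a)) + τ * f (b - τ) / ((b - c - τ) * (b - c)) ≤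
      ∫ v, φ v / (v - c) := by
  obtain ⟨hσ0, hσ1⟩ := hσ
  obtain ⟨hτ0, hτ1⟩ := hτ
  have s1 : (∫ v in Set.Iic (a + σ), φ v) = f (a + σ) := by
    have := integral_Iic_of_hasDerivAt_of_tendsto' (a := a + σ) (fun x _ => hd x) hint.integrableOn hbot
    simpa using this
  have s4 : (∫ v in Set.Ioi (b - τ), φ v) = - f (b - τ) := by
    have := integral_Ioi_of_hasDerivAt_of_tendsto' (a := b - τ) (fun x _ => hd x) hint.integrableOn htop
    simpa using this
  have s2 : (∫ v in Set.Ioc (a + σ) c, φ v) = - f (a + σ) := by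
    rw [← intervalIntegral.integral_of_le (by linarith),
      intervalIntegral.integral_eq_sub_of_hasDerivAt (fun x _ => hd x) hint.intervalIntegrable, hc0]
    ring
  have s3 : (∫ v in Set.Ioc c (b - τ), φ v) = f (b - τ) := by
    rw [← intervalIntegral.integral_of_le (by linarith),
      intervalIntegral.integral_eq_sub_of_hasDerivAt (fun x _ => hd x) hint.intervalIntegrable, hc0]
    ring
  have p1 := int_piece (s := Set.Iic (a + σ)) measurableSet_Iic (1 / (a - c)) hint hi (by
    intro v hv
    have hv : v ≤ a + σ := hv
    rw [mul_one_div]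
    have e : φ v / (v - c) - φ v / (a - c) = φ v * (a - v) / ((c - v) * (c - a)) := by
      have : v - c ≠ 0 := by linarith
      have : a - c ≠ 0 := by linarith
      have : c - v ≠ 0 := by linarith
      have : c - a ≠ 0 := by linarith
      field_simp
      ring
    have : 0 ≤ φ v * (a - v) := by
      rcases lt_trichotomy v a with h | h | h
      · exact mul_nonneg (hp1 v h).le (by linarith)
      · rw [h]; simp
      · exact mul_nonneg_of_nonpos_of_nonpos (hn1 v h (by linarith)).le (by linarith)
    have : 0 ≤ φ v * (a - v) / ((c - v) * (c - a)) :=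
      div_nonneg this (mul_nonneg (by linarith) (by linarith))
    linarith)
  have p2 := int_piece (s := Set.Ioc (a + σ) c) measurableSet_Ioc (1 / (a + σ - c)) hint hi (by
    rintro v ⟨hv1, hv2⟩
    rw [mul_one_div]
    rcases hv2.lt_or_eq with hv2 | hv2
    · have e : φ v / (v - c) - φ v / (a + σ - c) = φ v * (a + σ - v) / ((c - v) * (c - (a + σ))) := by
        have : v - c ≠ 0 := by linarith
        have : a + σ - c ≠ 0 := by linarith
        have : c - v ≠ 0 := by linarith
        have : c - (a + σ) ≠ 0 := by linarith
        field_simp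
        ring
      have : 0 ≤ φ v * (a + σ - v) / ((c - v) * (c - (a + σ))) :=
        div_nonneg (mul_nonneg_of_nonpos_of_nonpos (hn1 v (by linarith) hv2).le (by linarith))
          (mul_nonneg (by linarith) (by linarith))
      linarith
    · rw [hv2, hc]; simp)
  have p3 := int_piece (s := Set.Ioc c (b - τ)) measurableSet_Ioc (1 / (b - τ - c)) hint hi (by
    rintro v ⟨hv1, hv2⟩
    rw [mul_one_div]
    have := hp2 v hv1 (by linarith)
    have : 0 < v - c := by linarith
    gcongr)
  have p4 := int_piece (s := Set.Ioi (b - τ)) measurableSet_Ioi (1 / (b - c)) hint hi (by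
    intro v hv
    have hv : b - τ < v := hv
    rw [mul_one_div]
    have e : φ v / (v - c) - φ v / (b - c) = φ v * (b - v) / ((v - c) * (b - c)) := by
      have : v - c ≠ 0 := by linarith
      have : b - c ≠ 0 := by linarith
      field_simp
      ring
    have : 0 ≤ φ v * (b - v) := by
      rcases lt_trichotomy v b with h | h | h
      · exact mul_nonneg (hp2 v (by linarith) h).le (by linarith)
      · rw [h]; simp
      · exact mul_nonneg_of_nonpos_of_nonpos (hn2 v h).le (by linarith)
    have : 0 ≤ φ v * (b - v) / ((v - c) * (b - c)) :=
      div_nonneg this (mul_nonneg (by linarith) (by linarith))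
    linarith)
  rw [s1] at p1
  rw [s2] at p2
  rw [s3] at p3
  rw [s4] at p4
  have q1 : (∫ v in Set.Iic (a + σ), φ v / (v - c)) + (∫ v in Set.Ioc (a + σ) c, φ v / (v - c)) =
      ∫ v in Set.Iic c, φ v / (v - c) := by
    rw [← setIntegral_union (Set.Iic_disjoint_Ioc le_rfl) measurableSet_Ioc hi.integrableOn hi.integrableOn,
      Set.Iic_union_Ioc_eq_Iic (by linarith)]
  have q2 : (∫ v in Set.Ioc c (b - τ), φ v / (v - c)) + (∫ v in Set.Ioi (b - τ), φ v / (v - c)) =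
      ∫ v in Set.Ioi c, φ v / (v - c) := by
    rw [← setIntegral_union (Set.Ioc_disjoint_Ioi le_rfl) measurableSet_Ioi hi.integrableOn hi.integrableOn,
      Set.Ioc_union_Ioi_eq_Ioi (by linarith)]
  have q3 := intervalIntegral.integral_Iic_add_Ioi (b := c) hi.integrableOn hi.integrableOn
  have e1 : σ * f (a + σ) / ((c - a - σ) * (c - a)) =
      f (a + σ) * (1 / (a - c)) + -f (a + σ) * (1 / (a + σ - c)) := by
    have : a + σ - c ≠ 0 := by linarith
    have : a - c ≠ 0 := by linarith
    have : c - a - σ ≠ 0 := by linarith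
    have : c - a ≠ 0 := by linarith
    field_simp
    ring
  have e2 : τ * f (b - τ) / ((b - c - τ) * (b - c)) =
      f (b - τ) * (1 / (b - τ - c)) + -f (b - τ) * (1 / (b - c)) := by
    have : b - τ - c ≠ 0 := by linarith
    have : b - c - τ ≠ 0 := by linarith
    have : b - c ≠ 0 := by linarith
    field_simp
    ring
  linarith

lemma Lb_neg {f φ : ℝ → ℝ} (hd : ∀ x, HasDerivAt f (φ x) x) (hint : Integrable φ)
    {a b : ℝ} (hab : a ≤ b) (heq : f a = f b) (u m : ℝ)
    (hi : Integrable (fun v => φ v / (v - u)))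
    (h1 : ∀ v, v ∈ Set.Ioc a b → φ v / (v - u) ≤ φ v * m)
    (h2 : ∀ v, v ∉ Set.Ioc a b → φ v / (v - u) ≤ 0) : (∫ v, φ v / (v - u)) ≤ 0 := by
  have : (∫ v, φ v / (v - u)) ≤ ∫ v, Set.indicator (Set.Ioc a b) (fun v => φ v * m) v := by
    refine integral_mono hi ((hint.mul_const m).indicator measurableSet_Ioc) fun v => ?_
    by_cases hv : v ∈ Set.Ioc a b
    · simp only [Set.indicator_of_mem hv]; exact h1 v hv
    · simp only [Set.indicator_of_notMem hv]; exact h2 v hv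
  refine this.trans (le_of_eq ?_)
  rw [integral_indicator measurableSet_Ioc, integral_mul_const, ← intervalIntegral.integral_of_le hab,
    intervalIntegral.integral_eq_sub_of_hasDerivAt (fun x _ => hd x) hint.intervalIntegrable, heq]
  simp

/-- Lemma 6. In the two-stream configuration, if there are
`σ ∈ (0, c-a)`, `τ ∈ (0, b-c)` with
`σ f₀(a+σ)/((c-a-σ)(c-a)) + τ f₀(b-τ)/((b-c-τ)(b-c)) > k²`, then there is exactly one
unstable root `λ` of `Δ(k,·)` with `Re λ > 0`. -/
theorem two_stream_instability_levels (f₀ : ℝ → ℝ) (hf : ContDiff ℝ 1 f₀)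
    (htop : Tendsto f₀ atTop (nhds 0)) (hbot : Tendsto f₀ atBot (nhds 0))
    (φ : ℝ → ℝ) (hφ : φ = deriv f₀)
    (hint : Integrable φ)
    (hφd : Differentiable ℝ φ) (hφbd : ∃ C : ℝ, ∀ v : ℝ, |deriv φ v| ≤ C)
    (a c b : ℝ) (hac : a < c) (hcb : c < b)
    (hp1 : ∀ v : ℝ, v < a → 0 < φ v)
    (hp2 : ∀ v : ℝ, c < v → v < b → 0 < φ v)
    (hn1 : ∀ v : ℝ, a < v → v < c → φ v < 0)
    (hn2 : ∀ v : ℝ, b < v → φ v < 0)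
    (heq : f₀ a = f₀ b) (hapos : 0 < f₀ a) (hc0 : f₀ c = 0)
    (k : ℝ) (hk : k ≠ 0)
    (σ τ : ℝ) (hσ : σ ∈ Set.Ioo 0 (c - a)) (hτ : τ ∈ Set.Ioo 0 (b - c))
    (hcond : k ^ 2 < σ * f₀ (a + σ) / ((c - a - σ) * (c - a)) +
        τ * f₀ (b - τ) / ((b - c - τ) * (b - c))) :
    ∃! l : ℂ, 0 < l.re ∧ Landau φ k l = 0 := by
  have hd : ∀ x, HasDerivAt f₀ (φ x) x := by
    intro x
    rw [hφ]
    exact (hf.differentiable one_ne_zero x).hasDerivAt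
  have hcont : Continuous φ := hφd.continuous
  obtain ⟨C, hC⟩ := hφbd
  have hL : ∀ x y, |φ x - φ y| ≤ C * |x - y| := by
    intro x y
    exact Convex.norm_image_sub_le_of_norm_deriv_le (s := Set.univ) (fun v _ => hφd v)
      (fun v _ => hC v) convex_univ (Set.mem_univ y) (Set.mem_univ x)
  have hφ0 : Tendsto φ (cocompact ℝ) (nhds 0) := by
    refine phi_zero hd hL ?_
    rw [cocompact_eq_atBot_atTop]
    exact hbot.sup htop
  have left : ∀ u w : ℝ, w < u → (∀ v, w < v → v < u → 0 ≤ φ v) → 0 ≤ φ u := by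
    intro u w hwu h
    refine ge_of_tendsto (hcont.continuousWithinAt (s := Set.Iio u)) ?_
    filter_upwards [Ioo_mem_nhdsLT hwu] with v hv using h v hv.1 hv.2
  have left' : ∀ u w : ℝ, w < u → (∀ v, w < v → v < u → φ v ≤ 0) → φ u ≤ 0 := by
    intro u w hwu h
    refine le_of_tendsto (hcont.continuousWithinAt (s := Set.Iio u)) ?_
    filter_upwards [Ioo_mem_nhdsLT hwu] with v hv using h v hv.1 hv.2
  have right : ∀ u w : ℝ, u < w → (∀ v, u < v → v < w → 0 ≤ φ v) → 0 ≤ φ u := by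
    intro u w hwu h
    refine ge_of_tendsto (hcont.continuousWithinAt (s := Set.Ioi u)) ?_
    filter_upwards [Ioo_mem_nhdsGT hwu] with v hv using h v hv.1 hv.2
  have right' : ∀ u w : ℝ, u < w → (∀ v, u < v → v < w → φ v ≤ 0) → φ u ≤ 0 := by
    intro u w hwu h
    refine le_of_tendsto (hcont.continuousWithinAt (s := Set.Ioi u)) ?_
    filter_upwards [Ioo_mem_nhdsGT hwu] with v hv using h v hv.1 hv.2
  have ha : φ a = 0 := le_antisymm (right' a c hac fun v h1 h2 => (hn1 v h1 h2).le)
    (left a (a - 1) (by linarith) fun v _ h2 => (hp1 v h2).le)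
  have hc : φ c = 0 := le_antisymm (left' c a hac fun v h1 h2 => (hn1 v h1 h2).le)
    (right c b hcb fun v h1 h2 => (hp2 v h1 h2).le)
  have hb : φ b = 0 := le_antisymm (right' b (b + 1) (by linarith) fun v h1 _ => (hn2 v h1).le)
    (left b c hcb fun v h1 h2 => (hp2 v h1 h2).le)
  have hcases : ∀ v, (v < a ∧ 0 < φ v) ∨ v = a ∨ (a < v ∧ v < c ∧ φ v < 0) ∨ v = c ∨
      (c < v ∧ v < b ∧ 0 < φ v) ∨ v = b ∨ (b < v ∧ φ v < 0) := by
    intro v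
    rcases lt_trichotomy v a with h | h | h
    · exact Or.inl ⟨h, hp1 v h⟩
    · exact Or.inr (Or.inl h)
    rcases lt_trichotomy v c with h' | h' | h'
    · exact Or.inr (Or.inr (Or.inl ⟨h, h', hn1 v h h'⟩))
    · exact Or.inr (Or.inr (Or.inr (Or.inl h')))
    rcases lt_trichotomy v b with h'' | h'' | h''
    · exact Or.inr (Or.inr (Or.inr (Or.inr (Or.inl ⟨h', h'', hp2 v h' h''⟩))))
    · exact Or.inr (Or.inr (Or.inr (Or.inr (Or.inr (Or.inl h'')))))
    · exact Or.inr (Or.inr (Or.inr (Or.inr (Or.inr (Or.inr ⟨h'', hn2 v h''⟩)))))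
  have hsign : ∀ v, (v - a) * (v - b) * (v - c) * φ v ≤ 0 := by
    intro v
    rcases hcases v with ⟨h1, h2⟩ | h | ⟨h1, h2, h3⟩ | h | ⟨h1, h2, h3⟩ | h | ⟨h1, h2⟩
    · have : 0 ≤ (a - v) * (b - v) * (c - v) * φ v :=
        mul_nonneg (mul_nonneg (mul_nonneg (by linarith) (by linarith)) (by linarith)) h2.le
      linarith
    · simp [h]
    · have : 0 ≤ (v - a) * (b - v) * (c - v) * (-φ v) :=
        mul_nonneg (mul_nonneg (mul_nonneg (by linarith) (by linarith)) (by linarith)) (by linarith)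
      linarith
    · simp [h]
    · have : 0 ≤ (v - a) * (b - v) * (v - c) * φ v :=
        mul_nonneg (mul_nonneg (mul_nonneg (by linarith) (by linarith)) (by linarith)) h3.le
      linarith
    · simp [h]
    · have : 0 ≤ (v - a) * (v - b) * (v - c) * (-φ v) :=
        mul_nonneg (mul_nonneg (mul_nonneg (by linarith) (by linarith)) (by linarith)) (by linarith)
      linarith
  have hk2 : 0 < k ^ 2 := by positivity
  have hLc : k ^ 2 < Lb φ c := by
    obtain ⟨hi, e⟩ := Lb_zero hcont hint hL hc
    rw [e]
    exact hcond.trans_le (Lb_c_bound hd hint htop hbot hp1 hp2 hn1 hn2 ha hb hc hc0 hi σ τ hσ hτ)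
  have hLa : Lb φ a ≤ 0 := by
    obtain ⟨hi, e⟩ := Lb_zero hcont hint hL ha
    rw [e]
    refine Lb_neg hd hint (hac.trans hcb).le heq a (1 / (c - a)) hi ?_ ?_
    · rintro v ⟨h1, h2⟩
      have e : φ v * (1 / (c - a)) - φ v / (v - a) = φ v * (v - c) / ((v - a) * (c - a)) := by
        have : v - a ≠ 0 := by linarith
        have : c - a ≠ 0 := by linarith
        field_simp
        ring
      have : 0 ≤ φ v * (v - c) := by
        rcases hcases v with ⟨h1, h2⟩ | h | ⟨h1, h2, h3⟩ | h | ⟨h1, h2, h3⟩ | h | ⟨h1, h2⟩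
        · linarith
        · simp [h, ha]
        · nlinarith
        · simp [h]
        · nlinarith
        · simp [h, hb]
        · linarith
      have : 0 ≤ φ v * (v - c) / ((v - a) * (c - a)) :=
        div_nonneg this (mul_nonneg (by linarith) (by linarith))
      linarith
    · intro v hv
      rcases le_or_gt v a with h | h
      · have : 0 ≤ φ v := by
          rcases h.lt_or_eq with h | h
          · exact (hp1 v h).le
          · rw [h, ha]
        exact div_nonpos_of_nonneg_of_nonpos this (by linarith)
      · have h' : b < v := by
          by_contra hn
          exact hv ⟨h, not_lt.1 hn⟩
        exact div_nonpos_of_nonpos_of_nonneg (hn2 v h').le (by linarith)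
  have hLb : Lb φ b ≤ 0 := by
    obtain ⟨hi, e⟩ := Lb_zero hcont hint hL hb
    rw [e]
    refine Lb_neg hd hint (hac.trans hcb).le heq b (1 / (c - b)) hi ?_ ?_
    · rintro v ⟨h1, h2⟩
      rcases h2.lt_or_eq with h2 | h2
      · have e : φ v * (1 / (c - b)) - φ v / (v - b) = φ v * (v - c) / ((b - v) * (b - c)) := by
          have : v - b ≠ 0 := by linarith
          have : c - b ≠ 0 := by linarith
          have : b - v ≠ 0 := by linarith
          have : b - c ≠ 0 := by linarith
          field_simp
          ring
        have : 0 ≤ φ v * (v - c) := by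
          rcases lt_trichotomy v c with h | h | h
          · nlinarith [hn1 v h1 h]
          · simp [h]
          · nlinarith [hp2 v h h2]
        have : 0 ≤ φ v * (v - c) / ((b - v) * (b - c)) :=
          div_nonneg this (mul_nonneg (by linarith) (by linarith))
        linarith
      · simp [h2, hb]
    · intro v hv
      rcases le_or_gt v a with h | h
      · have : 0 ≤ φ v := by
          rcases h.lt_or_eq with h | h
          · exact (hp1 v h).le
          · rw [h, ha]
        exact div_nonpos_of_nonneg_of_nonpos this (by linarith)
      · have h' : b < v := by
          by_contra hn
          exact hv ⟨h, not_lt.1 hn⟩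
        exact div_nonpos_of_nonpos_of_nonneg (hn2 v h').le (by linarith)
  have hzeros : ∀ u, φ u = 0 → u = c ∨ Lb φ u ≤ 0 := by
    intro u hu
    rcases hcases u with ⟨h1, h2⟩ | h | ⟨h1, h2, h3⟩ | h | ⟨h1, h2, h3⟩ | h | ⟨h1, h2⟩
    · linarith
    · right; rw [h]; exact hLa
    · linarith
    · exact Or.inl h
    · linarith
    · right; rw [h]; exact hLb
    · linarith
  obtain ⟨z, hz, hFz⟩ := Fz_exists hcont hint hL hφ0 hac hcb hn1 hp2 hc hzeros hk2 hLc
  have hk' : (k : ℂ) ≠ 0 := by exact_mod_cast hk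
  have key : ∀ w : ℂ, 0 < w.im * k → Fz φ w = ((k ^ 2 : ℝ) : ℂ) →
      ∃ l : ℂ, 0 < l.re ∧ Landau φ k l = 0 := by
    intro w hw hFw
    refine ⟨-I * k * w, ?_, ?_⟩
    · have : (-I * k * w).re = w.im * k := by simp; ring
      rw [this]; exact hw
    · rw [Landau_iff φ hk]
      have : I * (-I * k * w) / k = w := by
        field_simp
        simp
      rw [this, hFw]
  have hex : ∃ l : ℂ, 0 < l.re ∧ Landau φ k l = 0 := by
    rcases lt_or_gt_of_ne hk with h | h
    · refine key ((starRingEnd ℂ) z) ?_ ?_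
      · rw [Complex.conj_im]; nlinarith
      · rw [Fz_conj, hFz, Complex.conj_ofReal]
    · exact key z (mul_pos hz h) hFz
  obtain ⟨l, hl, hl0⟩ := hex
  refine ⟨l, ⟨hl, hl0⟩, ?_⟩
  rintro m ⟨hm, hm0⟩
  rw [Landau_iff φ hk] at hl0 hm0
  have him : ∀ l : ℂ, (I * l / k).im = l.re / k := by
    intro l
    rw [Complex.div_ofReal_im]
    simp
  have := Fz_unique hint hsign (z := I * m / k) (w := I * l / k) (by
    rw [him, him, div_mul_div_comm]
    exact div_pos (mul_pos hm hl) (mul_self_pos.2 hk)) hk2 hm0 hl0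
  field_simp at this
  simpa using this
end

section
/- Let ψ : ℝ → ℝ be integrable and continuously differentiable with bounded derivative, and with ψ(v) → 0 as v → ±∞. Then ∫_ℝ ψ(v)/(v − z) dv → 0 as z → ∞ in the closed upper half-plane: for every ε > 0 there exists R > 0 such that every z ∈ ℂ with Im z > 0 and |z| ≥ R satisfies | ∫_ℝ ψ(v)/(v − z) dv | < ε. -/
open MeasureTheory Complex Filter

lemma aux_log (x y d : ℝ) (hy : 0 < y) (z : ℂ) (hz : z = x + y * I) :
    ‖∫ v in (x-d)..(x+d), ((v : ℂ) - z)⁻¹‖ ≤ 2 * Real.pi := by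
  have him : ∀ v : ℝ, ((v : ℂ) - z).im = -y := by intro v; simp [hz]
  have hne : ∀ v : ℝ, ((v : ℂ) - z) ≠ 0 := by
    intro v h
    have := him v
    rw [h] at this; simp at this; linarith
  have hder : ∀ v : ℝ, HasDerivAt (fun v : ℝ => Complex.log ((v : ℂ) - z)) (((v : ℂ) - z)⁻¹) v := by
    intro v
    have h1 : HasDerivAt (fun v : ℝ => (v : ℂ) - z) 1 v :=
      (Complex.ofRealCLM.hasDerivAt (x := v)).sub_const z
    have h2 := h1.clog_real (by
      rw [Complex.mem_slitPlane_iff]; right; rw [him]; linarith)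
    simpa using h2
  have hcont : Continuous (fun v : ℝ => ((v : ℂ) - z)⁻¹) := by
    apply Continuous.inv₀ (by fun_prop) hne
  rw [intervalIntegral.integral_eq_sub_of_hasDerivAt (fun v _ => hder v)
    (hcont.intervalIntegrable _ _)]
  have hn : ‖((x + d : ℝ) : ℂ) - z‖ = ‖((x - d : ℝ) : ℂ) - z‖ := by
    rw [← sq_eq_sq₀ (norm_nonneg _) (norm_nonneg _), ← Complex.normSq_eq_norm_sq,
      ← Complex.normSq_eq_norm_sq, Complex.normSq_apply, Complex.normSq_apply]
    simp [hz]
  have : Complex.log (((x + d : ℝ) : ℂ) - z) - Complex.log (((x - d : ℝ) : ℂ) - z)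
      = ((arg (((x + d : ℝ) : ℂ) - z) - arg (((x - d : ℝ) : ℂ) - z) : ℝ) : ℂ) * I := by
    rw [Complex.log, Complex.log, hn]; push_cast; ring
  rw [this, norm_mul, Complex.norm_I, mul_one, Complex.norm_real, Real.norm_eq_abs]
  have a1 := Complex.abs_arg_le_pi (((x + d : ℝ) : ℂ) - z)
  have a2 := Complex.abs_arg_le_pi (((x - d : ℝ) : ℂ) - z)
  rw [abs_le] at *
  constructor <;> linarith

lemma aux_tend (ψ : ℝ → ℝ) (hint : Integrable ψ) (d : ℝ) (hd : 0 < d) :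
    Tendsto (fun z : ℂ => ∫ v : ℝ, |ψ v| * min d⁻¹ ‖(v : ℂ) - z‖⁻¹)
      (Bornology.cobounded ℂ) (nhds 0) := by
  have hcg : (Bornology.cobounded ℂ).IsCountablyGenerated := by
    rw [← comap_norm_atTop]; infer_instance
  have : (0 : ℝ) = ∫ v : ℝ, (0 : ℝ) := by simp
  rw [this]
  apply tendsto_integral_filter_of_dominated_convergence (fun v => |ψ v| * d⁻¹)
  · refine Eventually.of_forall fun z => ?_
    apply hint.abs.aestronglyMeasurable.mul
    apply Measurable.aestronglyMeasurable
    fun_prop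
  · refine Eventually.of_forall fun z => Eventually.of_forall fun v => ?_
    have h0 : 0 ≤ min d⁻¹ ‖(v : ℂ) - z‖⁻¹ := by positivity
    rw [Real.norm_eq_abs, abs_of_nonneg (by positivity)]
    gcongr
    exact min_le_left _ _
  · exact hint.abs.mul_const _
  · refine Eventually.of_forall fun v => ?_
    have h1 : Tendsto (fun z : ℂ => ‖(v : ℂ) - z‖) (Bornology.cobounded ℂ) atTop := by
      refine tendsto_atTop_mono (f := fun z : ℂ => ‖z‖ - ‖(v:ℂ)‖) ?_ ?_
      · intro z
        rw [norm_sub_rev]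
        exact norm_sub_norm_le _ _
      · exact tendsto_atTop_add_const_right _ _ tendsto_norm_cobounded_atTop
    have h2 := h1.inv_tendsto_atTop
    have h3 : Tendsto (fun z : ℂ => min d⁻¹ ‖(v : ℂ) - z‖⁻¹) (Bornology.cobounded ℂ) (nhds 0) :=
      squeeze_zero (fun z => by positivity) (fun z => min_le_right _ _) h2
    simpa using h3.const_mul |ψ v|

/-- For `ψ` integrable, continuously differentiable with bounded
derivative and vanishing at `±∞`, the Cauchy-type integral `∫ ψ(v)/(v - z) dv` tends to
`0` as `z → ∞` in the upper half-plane. -/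
theorem cauchy_integral_vanishes_at_infinity (ψ : ℝ → ℝ)
    (hint : Integrable ψ) (hc : ContDiff ℝ 1 ψ)
    (hbd : ∃ M : ℝ, ∀ v : ℝ, |deriv ψ v| ≤ M)
    (htop : Tendsto ψ atTop (nhds 0)) (hbot : Tendsto ψ atBot (nhds 0)) :
    ∀ ε > (0 : ℝ), ∃ R > (0 : ℝ), ∀ z : ℂ, 0 < z.im → R ≤ ‖z‖ →
      ‖∫ v : ℝ, (ψ v : ℂ) / ((v : ℂ) - z)‖ < ε := by
  intro ε hε
  obtain ⟨M, hM⟩ := hbd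
  have hM0 : 0 ≤ M := (abs_nonneg _).trans (hM 0)
  obtain ⟨d, hd, hdM⟩ : ∃ d : ℝ, 0 < d ∧ M * (2 * d) ≤ ε / 3 := by
    refine ⟨ε / (6 * (M + 1)), by positivity, ?_⟩
    have : M * (2 * (ε / (6 * (M + 1)))) = ε / 3 * (M / (M + 1)) := by field_simp; ring
    rw [this]
    apply mul_le_of_le_one_right (by positivity)
    rw [div_le_one (by positivity)]; linarith
  have hG := aux_tend ψ hint d hd
  have hG' := hG.eventually (gt_mem_nhds (show (0:ℝ) < ε / 3 by positivity))
  rw [← comap_norm_atTop, eventually_comap] at hG'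
  obtain ⟨R1, hR1⟩ := eventually_atTop.1 hG'
  have hψabs1 := (tendsto_order.1 htop.abs).2 (ε / 24) (by simpa using hε)
  have hψabs2 := (tendsto_order.1 hbot.abs).2 (ε / 24) (by simpa using hε)
  obtain ⟨A, hA⟩ := eventually_atTop.1 hψabs1
  obtain ⟨B, hB⟩ := eventually_atBot.1 hψabs2
  refine ⟨max 1 (max R1 (d + |A| + |B|)), by positivity, fun z hzim hz => ?_⟩
  have hzR1 : R1 ≤ ‖z‖ := le_trans (by simp) hz
  have hzAB : d + |A| + |B| ≤ ‖z‖ := le_trans (by simp) hz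
  have hg : ∫ v : ℝ, |ψ v| * min d⁻¹ ‖(v : ℂ) - z‖⁻¹ < ε / 3 := hR1 _ hzR1 z rfl
  have him : ∀ v : ℝ, ((v : ℂ) - z).im = -z.im := by intro v; simp
  have hyn : ∀ v : ℝ, z.im ≤ ‖(v : ℂ) - z‖ := by
    intro v
    have := Complex.abs_im_le_norm ((v : ℂ) - z)
    rwa [him, abs_neg, abs_of_pos hzim] at this
  have hxn : ∀ v : ℝ, |v - z.re| ≤ ‖(v : ℂ) - z‖ := by
    intro v
    have := Complex.abs_re_le_norm ((v : ℂ) - z)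
    simpa using this
  have hpos : ∀ v : ℝ, 0 < ‖(v : ℂ) - z‖ := fun v => hzim.trans_le (hyn v)
  have hne : ∀ v : ℝ, (v : ℂ) - z ≠ 0 := fun v => norm_pos_iff.1 (hpos v)
  have hcinv : Continuous (fun v : ℝ => ((v : ℂ) - z)⁻¹) :=
    Continuous.inv₀ (by fun_prop) hne
  have hψc : Continuous ψ := hc.continuous
  have hgint : Integrable (fun v : ℝ => |ψ v| * min d⁻¹ ‖(v : ℂ) - z‖⁻¹) := by
    refine (hint.abs.mul_const d⁻¹).mono' ?_ ?_
    · apply hint.abs.aestronglyMeasurable.mul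
      apply Measurable.aestronglyMeasurable
      fun_prop
    · refine Eventually.of_forall fun v => ?_
      have h0 : 0 ≤ min d⁻¹ ‖(v : ℂ) - z‖⁻¹ := by positivity
      rw [Real.norm_eq_abs, abs_of_nonneg (by positivity)]
      gcongr
      exact min_le_left _ _
  have hg0 : ∀ v : ℝ, 0 ≤ |ψ v| * min d⁻¹ ‖(v : ℂ) - z‖⁻¹ := fun v => by positivity
  have hfg : ∀ v : ℝ, d ≤ ‖(v : ℂ) - z‖ →
      ‖(ψ v : ℂ) / ((v : ℂ) - z)‖ ≤ |ψ v| * min d⁻¹ ‖(v : ℂ) - z‖⁻¹ := by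
    intro v hv
    rw [min_eq_right (inv_anti₀ hd hv), norm_div, Complex.norm_real, Real.norm_eq_abs,
      div_eq_mul_inv]
  by_cases hy : d ≤ z.im
  · have := norm_integral_le_of_norm_le hgint
      (Eventually.of_forall fun v => hfg v (hy.trans (hyn v)))
    linarith
  push Not at hy
  have hfint : Integrable (fun v : ℝ => (ψ v : ℂ) / ((v : ℂ) - z)) := by
    refine (hint.abs.mul_const z.im⁻¹).mono' ?_ ?_
    · simp only [div_eq_mul_inv]
      exact (Continuous.mul (by fun_prop) hcinv).aestronglyMeasurable
    · refine Eventually.of_forall fun v => ?_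
      rw [norm_div, Complex.norm_real, Real.norm_eq_abs, div_eq_mul_inv]
      gcongr
      exact hyn v
  set x := z.re with hx
  have hψx : |ψ x| < ε / 24 := by
    have h1 : |A| + |B| < |x| := by
      have := Complex.norm_le_abs_re_add_abs_im z
      rw [abs_of_pos hzim] at this
      linarith
    rcases le_or_gt 0 x with h | h
    · apply hA
      rw [abs_of_nonneg h] at h1
      linarith [le_abs_self A, abs_nonneg B]
    · apply hB
      rw [abs_of_neg h] at h1
      linarith [neg_abs_le B, abs_nonneg A]
  rw [← integral_add_compl (measurableSet_Ioc (a := x - d) (b := x + d)) hfint]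
  have hfar : ‖∫ v in (Set.Ioc (x-d) (x+d))ᶜ, (ψ v : ℂ) / ((v : ℂ) - z)‖ < ε / 3 := by
    refine lt_of_le_of_lt ?_ hg
    refine le_trans (norm_integral_le_of_norm_le hgint.integrableOn ?_)
      (setIntegral_le_integral hgint (Eventually.of_forall hg0))
    refine (ae_restrict_iff' measurableSet_Ioc.compl).2 (Eventually.of_forall fun v hv => ?_)
    apply hfg
    refine le_trans ?_ (hxn v)
    by_contra hlt
    push Not at hlt
    rw [abs_lt] at hlt
    exact hv ⟨by linarith, by linarith⟩
  have hlip : ∀ v : ℝ, |ψ v - ψ x| ≤ M * |v - x| := by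
    intro v
    have := Convex.norm_image_sub_le_of_norm_deriv_le (f := ψ) (s := Set.univ) (C := M)
      (x := x) (y := v)
      (fun t _ => hc.differentiable (by norm_num) t) (fun t _ => hM t) convex_univ
      (Set.mem_univ _) (Set.mem_univ _)
    simpa using this
  have hnear : ‖∫ v in Set.Ioc (x-d) (x+d), (ψ v : ℂ) / ((v : ℂ) - z)‖
      ≤ M * (2 * d) + |ψ x| * (2 * Real.pi) := by
    rw [← intervalIntegral.integral_of_le (by linarith)]
    have e : ∀ v : ℝ, (ψ v : ℂ) / ((v : ℂ) - z)
        = ((ψ v - ψ x : ℝ) : ℂ) * ((v : ℂ) - z)⁻¹ + (ψ x : ℂ) * ((v : ℂ) - z)⁻¹ := by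
      intro v; push_cast; ring
    simp only [e]
    have c1 : Continuous (fun v : ℝ => ((ψ v - ψ x : ℝ) : ℂ) * ((v : ℂ) - z)⁻¹) :=
      Continuous.mul (by fun_prop) hcinv
    have c2 : Continuous (fun v : ℝ => (ψ x : ℂ) * ((v : ℂ) - z)⁻¹) :=
      continuous_const.mul hcinv
    rw [intervalIntegral.integral_add (c1.intervalIntegrable _ _) (c2.intervalIntegrable _ _),
      intervalIntegral.integral_const_mul]
    refine (norm_add_le _ _).trans (add_le_add ?_ ?_)
    · have := intervalIntegral.norm_integral_le_of_norm_le_const (a := x - d) (b := x + d)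
        (C := M) (f := fun v : ℝ => ((ψ v - ψ x : ℝ) : ℂ) * ((v : ℂ) - z)⁻¹) (by
          intro v _
          rw [norm_mul, norm_inv, Complex.norm_real, Real.norm_eq_abs, ← div_eq_mul_inv,
            div_le_iff₀ (hpos v)]
          exact (hlip v).trans (mul_le_mul_of_nonneg_left (hxn v) hM0))
      have e2 : |x + d - (x - d)| = 2 * d := by
        rw [abs_of_nonneg] <;> linarith
      rwa [e2] at this
    · rw [norm_mul, Complex.norm_real, Real.norm_eq_abs]
      gcongr
      exact aux_log x z.im d hzim z (by rw [hx]; exact (Complex.re_add_im z).symm)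
  have hpi : |ψ x| * (2 * Real.pi) ≤ ε / 24 * 8 := by
    apply mul_le_mul hψx.le _ (by positivity) (by positivity)
    linarith [Real.pi_le_four]
  refine (norm_add_le _ _).trans_lt ?_
  linarith
end

section
/- Let f₀ : ℝ → ℝ be continuously differentiable with f₀(v) → 0 as v → ±∞, set φ = f₀′, assume φ integrable with bounded derivative, and suppose there are a < c < b with φ > 0 on (−∞,a) ∪ (c,b), φ < 0 on (a,c) ∪ (b,∞), f₀(a) = f₀(b) > 0 and f₀(c) = 0. Then ∫_ℝ φ(v)/(v−a) dv < 0 and ∫_ℝ φ(v)/(v−b) dv < 0. -/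
open MeasureTheory Filter

theorem ts_zero (φ : ℝ → ℝ) (hc : Continuous φ) (s l r : ℝ) (hl : l < s) (hr : s < r)
    (h1 : ∀ v, l < v → v < s → 0 < φ v) (h2 : ∀ v, s < v → v < r → φ v < 0) : φ s = 0 := by
  apply le_antisymm
  · have : Tendsto φ (nhdsWithin s (Set.Ioi s)) (nhds (φ s)) := hc.continuousAt.mono_left nhdsWithin_le_nhds
    refine le_of_tendsto this ?_
    filter_upwards [Ioo_mem_nhdsGT hr] with v hv
    exact (h2 v hv.1 hv.2).le
  · have : Tendsto φ (nhdsWithin s (Set.Iio s)) (nhds (φ s)) := hc.continuousAt.mono_left nhdsWithin_le_nhds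
    refine ge_of_tendsto this ?_
    filter_upwards [Ioo_mem_nhdsLT hl] with v hv
    exact (h1 v hv.1 hv.2).le

theorem ts_int (φ : ℝ → ℝ) (hint : Integrable φ) (hφd : Differentiable ℝ φ) (M : ℝ)
    (hM : ∀ v : ℝ, |deriv φ v| ≤ M) (s : ℝ) (hs : φ s = 0) :
    Integrable (fun v => φ v / (v - s)) := by
  have hM0 : 0 ≤ M := (abs_nonneg _).trans (hM 0)
  have hI : Integrable (Set.indicator (Set.Icc (s-1) (s+1)) (fun _ : ℝ => M)) :=
    (integrable_indicator_iff measurableSet_Icc).2 (by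
      apply Continuous.integrableOn_Icc; fun_prop)
  refine (hint.norm.add hI).mono' ?_ ?_
  · have := hφd.continuous.measurable
    exact (this.div (by fun_prop)).aestronglyMeasurable
  · refine Eventually.of_forall fun v => ?_
    simp only [Pi.add_apply, Real.norm_eq_abs, abs_div]
    by_cases hv : v ∈ Set.Icc (s-1) (s+1)
    · rw [Set.indicator_of_mem hv]
      have h := Convex.norm_image_sub_le_of_norm_deriv_le (f := φ) (C := M) (s := Set.univ)
        (fun x _ => hφd x) (fun x _ => hM x) convex_univ (Set.mem_univ s) (Set.mem_univ v)
      rw [hs, sub_zero, Real.norm_eq_abs, Real.norm_eq_abs] at h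
      have : |φ v| / |v - s| ≤ M := div_le_of_le_mul₀ (abs_nonneg _) hM0 h
      linarith [abs_nonneg (φ v)]
    · rw [Set.indicator_of_notMem hv, add_zero]
      apply div_le_self (abs_nonneg _)
      by_contra! h
      rw [abs_lt] at h
      exact hv ⟨by linarith, by linarith⟩

theorem ts_main (f₀ : ℝ → ℝ) (hf : ContDiff ℝ 1 f₀)
    (φ : ℝ → ℝ) (hφ : φ = deriv f₀)
    (hint : Integrable φ)
    (a c b : ℝ) (hac : a < c) (hcb : c < b)
    (hp1 : ∀ v : ℝ, v < a → 0 < φ v)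
    (hp2 : ∀ v : ℝ, c < v → v < b → 0 < φ v)
    (hn1 : ∀ v : ℝ, a < v → v < c → φ v < 0)
    (hn2 : ∀ v : ℝ, b < v → φ v < 0)
    (heq : f₀ a = f₀ b) (ha : φ a = 0) (hb : φ b = 0) (s : ℝ) (hs : s = a ∨ s = b)
    (hi : Integrable (fun v => φ v / (v - s))) :
    (∫ v : ℝ, φ v / (v - s)) < 0 := by
  have has : a ≤ s := by rcases hs with h | h <;> linarith
  have hsb : s ≤ b := by rcases hs with h | h <;> linarith
  have hg : Integrable (Set.indicator (Set.Ioc a b) (fun v => φ v / (c - s))) :=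
    (hint.div_const _).indicator measurableSet_Ioc
  have hg0 : ∫ v, Set.indicator (Set.Ioc a b) (fun v => φ v / (c - s)) v = 0 := by
    rw [integral_indicator measurableSet_Ioc, ← intervalIntegral.integral_of_le (by linarith),
      intervalIntegral.integral_div, hφ, intervalIntegral.integral_deriv_eq_sub, heq]
    · simp
    · exact fun x _ => (hf.differentiable (by norm_num)) x
    · exact (hf.continuous_deriv (by norm_num)).intervalIntegrable _ _
  have key : 0 < ∫ v, (Set.indicator (Set.Ioc a b) (fun v => φ v / (c - s)) v - φ v / (v - s)) := by
    have hneg : ∀ v, v < a → φ v / (v - s) < 0 := fun v hv =>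
      div_neg_of_pos_of_neg (hp1 v hv) (by linarith)
    refine (integral_pos_iff_support_of_nonneg ?_ (hg.sub hi)).2 ?_
    rotate_left
    · refine lt_of_lt_of_le (b := volume (Set.Iio a)) (by simp) (measure_mono ?_)
      intro v hv
      have hv' : v ∉ Set.Ioc a b := fun h => absurd h.1 (not_lt.2 (le_of_lt hv))
      simp only [Function.mem_support, Pi.sub_apply, Set.indicator_of_notMem hv']
      have := hneg v hv
      intro h; linarith
    · intro v
      simp only [Pi.zero_apply, Pi.sub_apply]
      by_cases hv : v ∈ Set.Ioc a b
      · rw [Set.indicator_of_mem hv]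
        rcases eq_or_lt_of_le hv.2 with h | h
        · rw [h, hb]; simp
        have hpos : 0 < (v - s) * (c - s) := by
          rcases hs with h' | h'
          · exact mul_pos (by linarith [hv.1]) (by linarith)
          · exact mul_pos_of_neg_of_neg (by linarith) (by linarith)
        have h1 : v - s ≠ 0 := left_ne_zero_of_mul hpos.ne'
        have h2 : c - s ≠ 0 := right_ne_zero_of_mul hpos.ne'
        have : φ v / (c - s) - φ v / (v - s) = φ v * (v - c) / ((v - s) * (c - s)) := by
          field_simp; ring
        rw [this]
        refine div_nonneg ?_ hpos.le
        rcases lt_trichotomy v c with h3 | h3 | h3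
        · exact mul_nonneg_of_nonpos_of_nonpos (hn1 v hv.1 h3).le (by linarith)
        · simp [h3]
        · exact mul_nonneg (hp2 v h3 h).le (by linarith)
      · rw [Set.indicator_of_notMem hv]
        rcases lt_trichotomy v a with h | h | h
        · linarith [hneg v h]
        · simp [h, ha]
        · have h' : b < v := by
            by_contra! h'; exact hv ⟨h, h'⟩
          have := div_neg_of_neg_of_pos (hn2 v h') (show 0 < v - s by linarith)
          linarith
  rw [integral_sub hg hi, hg0] at key
  linarith

/-- In the two-stream configuration the integrals
`∫ φ(v)/(v-a) dv` and `∫ φ(v)/(v-b) dv` at the two maxima are negative, so that in the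
instability index formula only the minimum `c` can produce an unstable mode. -/
theorem two_stream_maxima_integrals_negative (f₀ : ℝ → ℝ) (hf : ContDiff ℝ 1 f₀)
    (htop : Tendsto f₀ atTop (nhds 0)) (hbot : Tendsto f₀ atBot (nhds 0))
    (φ : ℝ → ℝ) (hφ : φ = deriv f₀)
    (hint : Integrable φ)
    (hφd : Differentiable ℝ φ) (hφbd : ∃ M : ℝ, ∀ v : ℝ, |deriv φ v| ≤ M)
    (a c b : ℝ) (hac : a < c) (hcb : c < b)
    (hp1 : ∀ v : ℝ, v < a → 0 < φ v)
    (hp2 : ∀ v : ℝ, c < v → v < b → 0 < φ v)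
    (hn1 : ∀ v : ℝ, a < v → v < c → φ v < 0)
    (hn2 : ∀ v : ℝ, b < v → φ v < 0)
    (heq : f₀ a = f₀ b) (hapos : 0 < f₀ a) (hc0 : f₀ c = 0) :
    (∫ v : ℝ, φ v / (v - a)) < 0 ∧ (∫ v : ℝ, φ v / (v - b)) < 0 := by
  obtain ⟨M, hM⟩ := hφbd
  have ha : φ a = 0 := ts_zero φ hφd.continuous a (a-1) c (by linarith) hac
    (fun v _ h => hp1 v h) hn1
  have hb : φ b = 0 := ts_zero φ hφd.continuous b c (b+1) hcb (by linarith)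
    hp2 (fun v h _ => hn2 v h)
  exact ⟨ts_main f₀ hf φ hφ hint a c b hac hcb hp1 hp2 hn1 hn2 heq ha hb a (Or.inl rfl)
      (ts_int φ hint hφd M hM a ha),
    ts_main f₀ hf φ hφ hint a c b hac hcb hp1 hp2 hn1 hn2 heq ha hb b (Or.inr rfl)
      (ts_int φ hint hφd M hM b hb)⟩
end
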